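/- arXiv:1002.3448 — 2 statements merged into one kernel-verified Lean document; each statement's English description precedes it below -/
import Mathlib

section
/- Let Q be a probability distribution on ℝ^d with ∫ ‖x‖ Q(dx) < ∞ and such that csupp(Q) has nonempty interior. Then there exists a unique function ψ = ψ(·|Q) ∈ Φ(d) maximizing L(φ, Q) over all φ ∈ Φ(d). This maximizer satisfies ∫ e^{ψ(x)} dx = 1 and interior(csupp(Q)) ⊆ dom(ψ) := {x ∈ ℝ^d : ψ(x) > −∞} ⊆ csupp(Q). -/
open MeasureTheory Filter Topology Set
open scoped ENNReal RealInnerProductSpace BoundedContinuousFunction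

noncomputable section

/-- Truncation of an extended real number to `ℝ≥0∞`. -/
def EReal.toENN (x : EReal) : ℝ≥0∞ := if x = ⊤ then ⊤ else ENNReal.ofReal x.toReal

/-- The real-valued exponential of an extended real number (`⊤` is sent to `0`,
but this value is never used for functions in the class `Φ`). -/
def EReal.expR (x : EReal) : ℝ := (EReal.exp x).toReal

/-- The class `Φ(d)`: upper semicontinuous, concave functions `φ : E → [-∞, ∞)`
which are coercive in the sense that `φ x → -∞` as `‖x‖ → ∞`. -/
def IsPhi {E : Type*} [NormedAddCommGroup E] [NormedSpace ℝ E] (φ : E → EReal) : Prop :=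
  UpperSemicontinuous φ ∧ (∀ x, φ x ≠ ⊤) ∧
  (∀ x y : E, ∀ a b : ℝ, 0 < a → 0 < b → a + b = 1 →
    (a : EReal) * φ x + (b : EReal) * φ y ≤ φ (a • x + b • y)) ∧
  Tendsto φ (Filter.comap (fun x : E => ‖x‖) atTop) (𝓝 ⊥)

/-- The integral of an `EReal`-valued function with respect to a measure,
defined as the difference of the integrals of the positive and negative parts. -/
def eint {E : Type*} [MeasurableSpace E] (Q : Measure E) (φ : E → EReal) : EReal :=
  ((∫⁻ x, (φ x).toENN ∂Q : ℝ≥0∞) : EReal) - ((∫⁻ x, (-(φ x)).toENN ∂Q : ℝ≥0∞) : EReal)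

/-- The log-likelihood-type functional `L(φ, Q) = ∫ φ dQ - ∫ e^{φ(x)} dx + 1`. -/
def Lfun {E : Type*} [NormedAddCommGroup E] [NormedSpace ℝ E] [MeasureSpace E]
    (φ : E → EReal) (Q : Measure E) : EReal :=
  eint Q φ - ((∫⁻ x, EReal.exp (φ x) : ℝ≥0∞) : EReal) + 1

/-- The profile log-likelihood `L(Q) = sup_{φ ∈ Φ} L(φ, Q)`. -/
def Lprof {E : Type*} [NormedAddCommGroup E] [NormedSpace ℝ E] [MeasureSpace E]
    (Q : Measure E) : EReal :=
  ⨆ φ ∈ {φ : E → EReal | IsPhi φ}, Lfun φ Q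

/-- The convex support of a measure: the intersection of all closed convex sets of full
measure. -/
def csupp {E : Type*} [NormedAddCommGroup E] [NormedSpace ℝ E] [MeasurableSpace E]
    (Q : Measure E) : Set E :=
  ⋂₀ {C : Set E | IsClosed C ∧ Convex ℝ C ∧ Q C = 1}

/-- `ψ` is the (a) maximizer of `L(·, Q)` over `Φ`, i.e. `ψ = ψ(·|Q)`. -/
def IsMLE {E : Type*} [NormedAddCommGroup E] [NormedSpace ℝ E] [MeasureSpace E]
    (Q : Measure E) (ψ : E → EReal) : Prop :=
  IsPhi ψ ∧ ∀ φ : E → EReal, IsPhi φ → Lfun φ Q ≤ Lfun ψ Q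

/-- Weak convergence of a sequence of measures. -/
def WConv {E : Type*} [NormedAddCommGroup E] [MeasurableSpace E]
    (Qn : ℕ → Measure E) (Q : Measure E) : Prop :=
  ∀ g : E →ᵇ ℝ, Tendsto (fun n => ∫ x, g x ∂(Qn n)) atTop (𝓝 (∫ x, g x ∂Q))

/-- The Mallows (Wasserstein-1, Kantorovich–Rubinstein) distance. -/
def D1 {E : Type*} [NormedAddCommGroup E] [MeasurableSpace E] (Q Q' : Measure E) : ℝ :=
  sSup {r : ℝ | ∃ h : E → ℝ, LipschitzWith 1 h ∧ r = |(∫ x, h x ∂Q) - ∫ x, h x ∂Q'|}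

/-- The bounded Lipschitz distance. -/
def DBL (Q Q' : Measure ℝ) : ℝ :=
  sSup {r : ℝ | ∃ h : ℝ → ℝ, (∀ x, |h x| ≤ 1) ∧ LipschitzWith 1 h ∧
    r = |(∫ x, h x ∂Q) - ∫ x, h x ∂Q'|}

/-- The Kolmogorov–Smirnov distance. -/
def DKS (Q Q' : Measure ℝ) : ℝ :=
  ⨆ t : ℝ, |(Q' (Set.Iic t)).toReal - (Q (Set.Iic t)).toReal|

/-- Convolution of two measures. -/
def mconv {E : Type*} [NormedAddCommGroup E] [MeasurableSpace E] (Q R : Measure E) : Measure E :=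
  (Q.prod R).map (fun p => p.1 + p.2)

/-- The empirical measure of a finite tuple of real numbers. -/
def empQ {n : ℕ} (v : Fin n → ℝ) : Measure ℝ :=
  ((n : ℝ≥0∞))⁻¹ • ∑ i, Measure.dirac (v i)

end


open MeasureTheory Filter Topology Set
open scoped ENNReal RealInnerProductSpace BoundedContinuousFunction

/-- Concavity through real lower bounds. -/
def Conc {E : Type*} [NormedAddCommGroup E] [NormedSpace ℝ E] (φ : E → EReal) : Prop :=
  ∀ x y : E, ∀ a b : ℝ, 0 < a → 0 < b → a + b = 1 → ∀ s t : ℝ, (s : EReal) ≤ φ x →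
    (t : EReal) ≤ φ y → ((a * s + b * t : ℝ) : EReal) ≤ φ (a • x + b • y)

section basic
variable {E : Type*} [NormedAddCommGroup E] [NormedSpace ℝ E]

lemma conc_iff {φ : E → EReal} (h : ∀ x, φ x ≠ ⊤) : Conc φ ↔
    (∀ x y : E, ∀ a b : ℝ, 0 < a → 0 < b → a + b = 1 →
    (a : EReal) * φ x + (b : EReal) * φ y ≤ φ (a • x + b • y)) := by
  constructor
  · intro H x y a b ha hb hab
    have hx := h x
    have hy := h y
    have H' := H x y a b ha hb hab
    revert hx hy H'
    generalize φ x = u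
    generalize φ y = v
    intro hx hy H'
    induction u with
    | top => exact absurd rfl hx
    | bot => rw [EReal.coe_mul_bot_of_pos ha]; simp
    | coe u =>
      induction v with
      | top => exact absurd rfl hy
      | bot => rw [EReal.coe_mul_bot_of_pos hb]; simp
      | coe v => exact_mod_cast H' u v le_rfl le_rfl
  · intro H x y a b ha hb hab s t hs ht
    refine le_trans ?_ (H x y a b ha hb hab)
    rw [EReal.coe_add, EReal.coe_mul, EReal.coe_mul]
    exact add_le_add (mul_le_mul_of_nonneg_left hs (by exact_mod_cast ha.le))
      (mul_le_mul_of_nonneg_left ht (by exact_mod_cast hb.le))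

lemma IsPhi.conc {φ : E → EReal} (h : IsPhi φ) : Conc φ := (conc_iff h.2.1).2 h.2.2.1

lemma coercive_iff {φ : E → EReal} :
    Tendsto φ (Filter.comap (fun x : E => ‖x‖) atTop) (𝓝 ⊥) ↔
      ∀ K : ℝ, ∃ R : ℝ, ∀ x, R ≤ ‖x‖ → φ x < K := by
  rw [EReal.tendsto_nhds_bot_iff_real]
  refine forall_congr' fun K => ?_
  rw [Filter.eventually_comap, Filter.eventually_atTop]
  constructor
  · rintro ⟨R, hR⟩
    exact ⟨R, fun x hx => hR _ hx x rfl⟩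
  · rintro ⟨R, hR⟩
    exact ⟨R, fun b hb x hx => hR x (hx ▸ hb)⟩

lemma IsPhi.exists_max [FiniteDimensional ℝ E] {φ : E → EReal} (h : IsPhi φ) :
    ∃ x₀, ∀ x, φ x ≤ φ x₀ := by
  by_cases hb : ∀ x, φ x = ⊥
  · exact ⟨0, fun x => by simp [hb]⟩
  push Not at hb
  obtain ⟨x₁, hx₁⟩ := hb
  obtain ⟨u, hu⟩ : ∃ u : ℝ, φ x₁ = u := ⟨_, (EReal.coe_toReal (h.2.1 x₁) hx₁).symm⟩
  obtain ⟨R, hR⟩ := coercive_iff.1 h.2.2.2 u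
  have : ProperSpace E := FiniteDimensional.proper ℝ E
  have hx1R : x₁ ∈ Metric.closedBall (0:E) R := by
    rw [mem_closedBall_zero_iff]
    by_contra hc
    exact absurd (hR x₁ (not_le.1 hc).le) (by simp [hu])
  obtain ⟨x₀, hx₀, hmax⟩ := UpperSemicontinuousOn.exists_isMaxOn (f := φ) ⟨x₁, hx1R⟩
    (isCompact_closedBall (0:E) R) (h.1.upperSemicontinuousOn _)
  refine ⟨x₀, fun x => ?_⟩
  by_cases hx : x ∈ Metric.closedBall (0:E) R
  · exact hmax hx
  · rw [mem_closedBall_zero_iff] at hx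
    exact (hR x (not_le.1 hx).le).le.trans (hu ▸ hmax hx1R)

lemma IsPhi.exists_bound [FiniteDimensional ℝ E] {φ : E → EReal} (h : IsPhi φ) :
    ∃ M : ℝ, ∀ x, φ x ≤ M := by
  obtain ⟨x₀, h0⟩ := h.exists_max
  by_cases hb : φ x₀ = ⊥
  · exact ⟨0, fun x => (h0 x).trans (by simp [hb])⟩
  · exact ⟨(φ x₀).toReal, fun x => (h0 x).trans (by rw [EReal.coe_toReal (h.2.1 x₀) hb])⟩

lemma IsPhi.measurable [MeasurableSpace E] [BorelSpace E] {φ : E → EReal} (h : IsPhi φ) :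
    Measurable φ := h.1.measurable

/-- midpoint -/
noncomputable def midf (φ φ' : E → EReal) (x : E) : EReal :=
  ((1/2 : ℝ) : EReal) * φ x + ((1/2 : ℝ) : EReal) * φ' x

lemma half_ne_top {u : EReal} (h : u ≠ ⊤) : ((1/2 : ℝ) : EReal) * u ≠ ⊤ := by
  induction u with
  | top => exact absurd rfl h
  | bot => rw [EReal.coe_mul_bot_of_pos (by norm_num)]; simp
  | coe u => rw [← EReal.coe_mul]; exact EReal.coe_ne_top _

lemma cont_half : Continuous (fun u : EReal => ((1/2 : ℝ) : EReal) * u) := by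
  rw [continuous_iff_continuousAt]
  intro u
  have h0 : ((1/2 : ℝ) : EReal) ≠ 0 := by
    exact_mod_cast (by norm_num : (1/2 : ℝ) ≠ 0)
  exact (EReal.continuousAt_mul (p := (((1/2 : ℝ) : EReal), u)) (Or.inl h0) (Or.inl h0)
    (Or.inl (EReal.coe_ne_bot _)) (Or.inl (EReal.coe_ne_top _))).comp
      (f := fun u : EReal => (((1/2 : ℝ) : EReal), u)) (by fun_prop)

lemma IsPhi.mid {φ φ' : E → EReal} (h : IsPhi φ) (h' : IsPhi φ') : IsPhi (midf φ φ') := by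
  have hm : Monotone (fun u : EReal => ((1/2 : ℝ) : EReal) * u) := fun u v huv =>
    mul_le_mul_of_nonneg_left huv (by exact_mod_cast (by norm_num : (0:ℝ) ≤ 1/2))
  have htop : ∀ x, midf φ φ' x ≠ ⊤ := fun x =>
    EReal.add_ne_top (half_ne_top (h.2.1 x)) (half_ne_top (h'.2.1 x))
  refine ⟨?_, htop, (conc_iff htop).1 ?_, ?_⟩
  · refine UpperSemicontinuous.add' (cont_half.comp_upperSemicontinuous h.1 hm)
      (cont_half.comp_upperSemicontinuous h'.1 hm) fun x => ?_
    exact EReal.continuousAt_add (Or.inl (half_ne_top (h.2.1 x))) (Or.inr (half_ne_top (h'.2.1 x)))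
  · intro x y a b ha hb hab s t hs ht
    have key : ∀ {u v : EReal} {s : ℝ}, u ≠ ⊤ → v ≠ ⊤ →
        (s : EReal) ≤ ((1/2 : ℝ) : EReal) * u + ((1/2 : ℝ) : EReal) * v →
        ∃ u' v' : ℝ, (u' : EReal) ≤ u ∧ (v' : EReal) ≤ v ∧ s = 1/2 * u' + 1/2 * v' := by
      intro u v s hu hv hs
      induction u with
      | top => exact absurd rfl hu
      | bot => rw [EReal.coe_mul_bot_of_pos (by norm_num)] at hs; simp at hs
      | coe u =>
        induction v with
        | top => exact absurd rfl hv
        | bot => rw [EReal.coe_mul_bot_of_pos (by norm_num)] at hs; simp at hs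
        | coe v =>
          have hs' : s ≤ 1/2 * u + 1/2 * v := by exact_mod_cast hs
          refine ⟨u, 2 * s - u, le_rfl, ?_, by ring⟩
          rw [EReal.coe_le_coe_iff]; linarith
    obtain ⟨u, v, hu, hv, rfl⟩ := key (h.2.1 x) (h'.2.1 x) hs
    obtain ⟨u', v', hu', hv', rfl⟩ := key (h.2.1 y) (h'.2.1 y) ht
    have h1 := h.conc x y a b ha hb hab u u' hu hu'
    have h2 := h'.conc x y a b ha hb hab v v' hv hv'
    have := add_le_add (hm h1) (hm h2)
    refine le_trans (le_of_eq ?_) this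
    simp only [← EReal.coe_mul, ← EReal.coe_add]
    congr 1; ring
  · have hb : ((1/2 : ℝ) : EReal) * ⊥ = ⊥ := EReal.coe_mul_bot_of_pos (by norm_num)
    have t1 := (cont_half.tendsto ⊥).comp h.2.2.2
    have t2 := (cont_half.tendsto ⊥).comp h'.2.2.2
    rw [hb] at t1 t2
    have := (EReal.continuousAt_add (p := (⊥, ⊥)) (by simp) (by simp)).tendsto.comp
      (t1.prodMk_nhds t2)
    rw [show (((⊥ : EReal), (⊥ : EReal)).1 + ((⊥ : EReal), (⊥ : EReal)).2) = ⊥ by simp] at this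
    exact this

lemma IsPhi.add_const {φ : E → EReal} (h : IsPhi φ) (c : ℝ) :
    IsPhi (fun x => φ x + (c : EReal)) := by
  have hm : Monotone (fun u : EReal => u + (c : EReal)) := fun u v huv => by
    dsimp; gcongr
  have hc : Continuous (fun u : EReal => u + (c : EReal)) := by
    rw [continuous_iff_continuousAt]
    intro u
    exact (EReal.continuousAt_add (p := (u, (c : EReal))) (by simp) (by simp)).comp
      (f := fun u : EReal => (u, (c : EReal))) (by fun_prop)
  have htop : ∀ x, φ x + (c : EReal) ≠ ⊤ := fun x =>
    EReal.add_ne_top (h.2.1 x) (EReal.coe_ne_top _)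
  refine ⟨hc.comp_upperSemicontinuous h.1 hm, htop, (conc_iff htop).1 ?_, ?_⟩
  · intro x y a b ha hb hab s t hs ht
    have key : ∀ {u : EReal} {s : ℝ}, (s : EReal) ≤ u + c → ((s - c : ℝ) : EReal) ≤ u := by
      intro u s hs
      rw [EReal.coe_sub]
      exact EReal.sub_le_of_le_add hs
    have := hm (h.conc x y a b ha hb hab _ _ (key hs) (key ht))
    refine le_trans (le_of_eq ?_) this
    simp only [← EReal.coe_add]
    congr 1
    have : b = 1 - a := by linarith
    subst this; ring
  · have t1 := (hc.tendsto ⊥).comp h.2.2.2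
    rw [EReal.bot_add] at t1
    exact t1

open Classical in
/-- truncation to a set -/
noncomputable def truncf (C : Set E) (φ : E → EReal) (x : E) : EReal :=
  if x ∈ C then φ x else ⊥

lemma IsPhi.trunc {φ : E → EReal} (h : IsPhi φ) {C : Set E} (hC : IsClosed C)
    (hc : Convex ℝ C) : IsPhi (truncf C φ) := by
  have hle : ∀ x, truncf C φ x ≤ φ x := fun x => by unfold truncf; split_ifs <;> simp
  have htop : ∀ x, truncf C φ x ≠ ⊤ := fun x =>
    ne_top_of_le_ne_top (h.2.1 x) (hle x)
  refine ⟨?_, htop, (conc_iff htop).1 ?_, ?_⟩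
  · intro x c hxc
    by_cases hx : x ∈ C
    · have : φ x < c := by simpa [truncf, hx] using hxc
      exact (h.1 x c this).mono fun y hy => (hle y).trans_lt hy
    · filter_upwards [hC.isOpen_compl.mem_nhds hx] with y hy
      have : truncf C φ y = ⊥ := by simpa [truncf] using fun hh => absurd hh hy
      rw [this]; exact bot_le.trans_lt hxc
  · intro x y a b ha hb hab s t hs ht
    have hx : x ∈ C := by
      by_contra hx; simp [truncf, hx] at hs
    have hy : y ∈ C := by
      by_contra hx; simp [truncf, hx] at ht
    have hz := hc hx hy ha.le hb.le hab
    simp only [truncf, hx, hy, hz, if_true] at hs ht ⊢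
    exact h.conc x y a b ha hb hab s t hs ht
  · exact tendsto_of_tendsto_of_tendsto_of_le_of_le tendsto_const_nhds h.2.2.2
      (fun _ => bot_le) hle

end basic

open MeasureTheory Filter Topology Set
open scoped ENNReal RealInnerProductSpace BoundedContinuousFunction

set_option linter.unusedSectionVars false

section integrals
variable {E : Type*} [NormedAddCommGroup E] [NormedSpace ℝ E] [MeasureSpace E]

/-- integral of `M - φ` -/
noncomputable def Jf (Q : Measure E) (M : ℝ) (φ : E → EReal) : ℝ≥0∞ :=
  ∫⁻ x, ((M : EReal) - φ x).toENNReal ∂Q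

/-- integral of `exp φ` -/
noncomputable def If (φ : E → EReal) : ℝ≥0∞ := ∫⁻ x, EReal.exp (φ x)

lemma meas_sub (M : ℝ) : Measurable (fun u : EReal => ((M : EReal) - u).toENNReal) := by
  apply Antitone.measurable
  intro u v huv
  exact EReal.toENNReal_le_toENNReal (EReal.sub_le_sub le_rfl huv)

lemma toENN_eq (u : EReal) : u.toENN = u.toENNReal := rfl

lemma ptw_id {u : EReal} {M : ℝ} (hu : u ≤ M) :
    u.toENNReal + ((M : EReal) - u).toENNReal + ENNReal.ofReal (-M)
      = ENNReal.ofReal M + (-u).toENNReal := by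
  induction u with
  | top => simp at hu
  | bot => simp
  | coe u =>
    have hu' : u ≤ M := by exact_mod_cast hu
    rw [← EReal.coe_sub, ← EReal.coe_neg]
    simp only [EReal.toENNReal_of_ne_top (EReal.coe_ne_top _), EReal.toReal_coe]
    have h1 : ∀ r : ℝ, ENNReal.ofReal r = ENNReal.ofReal (max r 0) := fun r => by
      rw [ENNReal.ofReal_max]; simp
    rw [h1 u, h1 (M-u), h1 (-M), h1 M, h1 (-u)]
    rw [← ENNReal.ofReal_add (by positivity) (by positivity),
      ← ENNReal.ofReal_add (by positivity) (by positivity),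
      ← ENNReal.ofReal_add (by positivity) (by positivity)]
    congr 1
    rcases le_total u 0 with h | h <;> rcases le_total M 0 with h' | h' <;>
    simp [h, h', hu']
    all_goals linarith

lemma eint_eq {Q : Measure E} [IsProbabilityMeasure Q] {φ : E → EReal} (hφ : Measurable φ)
    {M : ℝ} (hM : ∀ x, φ x ≤ M) : eint Q φ = (M : EReal) - (Jf Q M φ : EReal) := by
  unfold eint
  simp only [toENN_eq]
  have hid : (∫⁻ x, (φ x).toENNReal ∂Q) + Jf Q M φ + ENNReal.ofReal (-M)
      = ENNReal.ofReal M + ∫⁻ x, (-(φ x)).toENNReal ∂Q := by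
    have h := lintegral_congr (μ := Q) fun x => ptw_id (hM x)
    rw [lintegral_add_right _ measurable_const, lintegral_add_left measurable_const,
      lintegral_add_left (f := fun x => (φ x).toENNReal) (measurable_ereal_toENNReal.comp hφ)] at h
    simpa [Jf] using h
  have hP : (∫⁻ x, (φ x).toENNReal ∂Q) ≠ ⊤ := by
    refine ne_top_of_le_ne_top (b := ENNReal.ofReal M) (by simp) ?_
    calc (∫⁻ x, (φ x).toENNReal ∂Q) ≤ ∫⁻ x, ENNReal.ofReal M ∂Q := by
          apply lintegral_mono
          intro x
          simpa using EReal.toENNReal_le_toENNReal (hM x)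
      _ = _ := by simp
  revert hid hP
  generalize (∫⁻ x, (φ x).toENNReal ∂Q) = P
  generalize (∫⁻ x, (-(φ x)).toENNReal ∂Q) = N
  generalize Jf Q M φ = J
  intro hid hP
  by_cases hJ : J = ⊤
  · subst hJ
    have : N = ⊤ := by
      by_contra hN
      have h2 : ENNReal.ofReal M + N ≠ ⊤ := by simp [hN]
      exact h2 (by rw [← hid]; simp)
    subst this
    simp
  · have hN : N ≠ ⊤ := by
      intro hN
      subst hN
      simp at hid
      tauto
    lift P to NNReal using hP
    lift N to NNReal using hN
    lift J to NNReal using hJ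
    have h3 : (P : ℝ) + J + max (-M) 0 = max M 0 + N := by
      have := congrArg ENNReal.toReal hid
      rw [ENNReal.toReal_add (by simp) (by simp), ENNReal.toReal_add (by simp) (by simp),
        ENNReal.toReal_add (by simp) (by simp)] at this
      simpa [ENNReal.toReal_ofReal'] using this
    have h4 : max M 0 - max (-M) 0 = M := max_zero_sub_max_neg_zero_eq_self M
    have h5 : (P : ℝ) - N = M - J := by linarith
    have e : ∀ r : NNReal, (((r : ℝ≥0∞)) : EReal) = ((r : ℝ) : EReal) := fun r => rfl
    rw [e, e, e, ← EReal.coe_sub, ← EReal.coe_sub, h5]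

lemma Lfun_eq {Q : Measure E} [IsProbabilityMeasure Q] {φ : E → EReal} (hφ : Measurable φ)
    {M : ℝ} (hM : ∀ x, φ x ≤ M) :
    Lfun φ Q = (M : EReal) - (Jf Q M φ : EReal) - (If φ : EReal) + 1 := by
  unfold Lfun; rw [eint_eq hφ hM]; rfl

lemma Lfun_eq_real {Q : Measure E} [IsProbabilityMeasure Q] {φ : E → EReal} (hφ : Measurable φ)
    {M : ℝ} (hM : ∀ x, φ x ≤ M) (hJ : Jf Q M φ ≠ ⊤) (hI : If φ ≠ ⊤) :
    Lfun φ Q = ((M - (Jf Q M φ).toReal - (If φ).toReal + 1 : ℝ) : EReal) := by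
  rw [Lfun_eq hφ hM]
  lift Jf Q M φ to NNReal using hJ with J
  lift If φ to NNReal using hI with I
  simp only [EReal.coe_add, EReal.coe_sub]
  rfl

lemma Lfun_ne_bot {Q : Measure E} [IsProbabilityMeasure Q] {φ : E → EReal} (hφ : Measurable φ)
    {M : ℝ} (hM : ∀ x, φ x ≤ M) (h : Lfun φ Q ≠ ⊥) : Jf Q M φ ≠ ⊤ ∧ If φ ≠ ⊤ := by
  rw [Lfun_eq hφ hM] at h
  constructor
  · intro hJ; apply h; rw [hJ]; simp
  · intro hI; apply h; rw [hI]; simp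

lemma Jf_mid {Q : Measure E} {φ φ' : E → EReal} [BorelSpace E] (hφ : Measurable φ) 
    {M : ℝ} (hM : ∀ x, φ x ≤ M) (hM' : ∀ x, φ' x ≤ M) :
    2 * Jf Q M (midf φ φ') = Jf Q M φ + Jf Q M φ' := by
  unfold Jf
  rw [← lintegral_add_left (f := fun x => ((M : EReal) - φ x).toENNReal) ((meas_sub M).comp hφ), ← lintegral_const_mul' _ _ (by simp)]
  apply lintegral_congr
  intro x
  unfold midf
  have hx := hM x
  have hx' := hM' x
  revert hx hx'
  generalize φ x = u
  generalize φ' x = v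
  intro hu hv
  have hb : ((1/2 : ℝ) : EReal) * ⊥ = ⊥ := EReal.coe_mul_bot_of_pos (by norm_num)
  induction u with
  | top => simp at hu
  | bot => rw [hb]; simp
  | coe u =>
    induction v with
    | top => simp at hv
    | bot => rw [hb]; simp
    | coe v =>
      have hu' : u ≤ M := by exact_mod_cast hu
      have hv' : v ≤ M := by exact_mod_cast hv
      simp only [← EReal.coe_mul, ← EReal.coe_add, ← EReal.coe_sub,
        EReal.toENNReal_of_ne_top (EReal.coe_ne_top _), EReal.toReal_coe]
      rw [← ENNReal.ofReal_add (by linarith) (by linarith),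
        show (2 : ℝ≥0∞) = ENNReal.ofReal 2 by simp, ← ENNReal.ofReal_mul (by norm_num)]
      congr 1; ring

lemma Jf_shift {Q : Measure E} {φ : E → EReal} (M c : ℝ) :
    Jf Q (M + c) (fun x => φ x + (c : EReal)) = Jf Q M φ := by
  unfold Jf
  apply lintegral_congr
  intro x
  congr 1
  dsimp only
  generalize φ x = u
  induction u with
  | top => simp
  | bot => simp
  | coe u =>
    rw [← EReal.coe_add, ← EReal.coe_sub, ← EReal.coe_sub]; congr 1; ring

lemma If_shift {φ : E → EReal} (c : ℝ) :
    If (fun x => φ x + (c : EReal)) = ENNReal.ofReal (Real.exp c) * If φ := by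
  unfold If
  rw [← lintegral_const_mul' _ _ (by simp)]
  apply lintegral_congr
  intro x
  rw [EReal.exp_add, EReal.exp_coe, mul_comm]

/-- root of exp -/
noncomputable def hf (φ : E → EReal) (x : E) : ℝ := Real.sqrt (EReal.exp (φ x)).toReal

lemma hf_meas {φ : E → EReal} (hφ : Measurable φ) : Measurable (hf φ) := by
  unfold hf
  exact (hφ.ereal_exp.ennreal_toReal).sqrt

lemma If_mid {φ φ' : E → EReal} (hφ : Measurable φ) (hφ' : Measurable φ')
    (h1 : ∀ x, φ x ≠ ⊤) (h2 : ∀ x, φ' x ≠ ⊤) :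
    (∫⁻ x, ENNReal.ofReal ((hf φ x - hf φ' x) ^ 2)) + 2 * If (midf φ φ') = If φ + If φ' := by
  unfold If
  rw [← lintegral_add_left (hφ.ereal_exp), ← lintegral_const_mul' _ _ (by simp),
    ← lintegral_add_left (by
      have := hf_meas hφ
      have := hf_meas hφ'
      fun_prop)]
  apply lintegral_congr
  intro x
  unfold midf hf
  have hx := h1 x
  have hx' := h2 x
  revert hx hx'
  generalize φ x = u
  generalize φ' x = v
  intro hu hv
  have hb : ((1/2 : ℝ) : EReal) * ⊥ = ⊥ := EReal.coe_mul_bot_of_pos (by norm_num)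
  have hs : ∀ u : ℝ, Real.sqrt (Real.exp u) = Real.exp (1/2 * u) := fun u => by
    rw [Real.sqrt_eq_iff_mul_self_eq (Real.exp_pos _).le (Real.exp_pos _).le, ← Real.exp_add]
    congr 1; ring
  have hs2 : ∀ u : ℝ, Real.exp (1/2 * u) ^ 2 = Real.exp u := fun u => by
    rw [sq, ← Real.exp_add]
    congr 1; ring
  induction u with
  | top => simp at hu
  | bot =>
    rw [hb]
    induction v with
    | top => simp at hv
    | bot => rw [hb]; simp
    | coe v =>
      simp only [EReal.exp_coe, EReal.exp_bot, EReal.bot_add,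
        ENNReal.toReal_ofReal (Real.exp_pos _).le, hs]
      simp [← hs2 v]
  | coe u =>
    induction v with
    | top => simp at hv
    | bot =>
      rw [hb]
      simp only [EReal.exp_coe, EReal.exp_bot, EReal.add_bot,
        ENNReal.toReal_ofReal (Real.exp_pos _).le, hs]
      simp [← hs2 u]
    | coe v =>
      simp only [← EReal.coe_mul, ← EReal.coe_add, EReal.exp_coe,
        ENNReal.toReal_ofReal (Real.exp_pos _).le, hs]
      rw [← ENNReal.ofReal_add (Real.exp_pos _).le (Real.exp_pos _).le,
        show (2 : ℝ≥0∞) = ENNReal.ofReal 2 by simp, ← ENNReal.ofReal_mul (by norm_num),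
        ← ENNReal.ofReal_add (by positivity) (by positivity), Real.exp_add, ← hs2 u, ← hs2 v]
      congr 1; ring

lemma ae_ne_bot {Q : Measure E} {φ : E → EReal} (hφ : Measurable φ)
    {M : ℝ} (hJ : Jf Q M φ ≠ ⊤) : ∀ᵐ x ∂Q, φ x ≠ ⊥ := by
  filter_upwards [ae_lt_top ((meas_sub M).comp hφ) hJ] with x hx hb
  simp [hb] at hx

end integrals

open MeasureTheory Filter Topology Set
open scoped ENNReal RealInnerProductSpace BoundedContinuousFunction
set_option linter.unusedSectionVars false

section convexgeom
variable {E : Type*} [NormedAddCommGroup E] [NormedSpace ℝ E] [MeasureSpace E] [BorelSpace E]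
  [FiniteDimensional ℝ E] [(volume : Measure E).IsAddHaarMeasure]

lemma interior_csupp_subset {Q : Measure E} [IsProbabilityMeasure Q]
    (hint : (interior (csupp Q)).Nonempty) {D : Set E} (hD : Convex ℝ D) (hQ : Q D = 1) :
    interior (csupp Q) ⊆ interior D := by
  have h1 : csupp Q ⊆ closure D := by
    apply sInter_subset_of_mem
    refine ⟨isClosed_closure, hD.closure, ?_⟩
    exact le_antisymm prob_le_one (hQ ▸ measure_mono subset_closure)
  have h2 : interior (csupp Q) ⊆ interior (closure D) := interior_mono h1
  have h3 := hint.mono h2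
  rw [hD.closure.interior_nonempty_iff_affineSpan_eq_top] at h3
  have h4 : affineSpan ℝ D = ⊤ := by
    rw [eq_top_iff, ← h3]
    apply affineSpan_le.2
    exact closure_minimal (subset_affineSpan ℝ D) (AffineSubspace.closed_of_finiteDimensional _)
  rw [← hD.interior_nonempty_iff_affineSpan_eq_top] at h4
  rwa [hD.interior_closure_eq_interior_of_nonempty_interior h4] at h2

lemma csupp_closed (Q : Measure E) : IsClosed (csupp Q) := isClosed_sInter fun _ h => h.1

lemma csupp_convex (Q : Measure E) : Convex ℝ (csupp Q) := convex_sInter fun _ h => h.2.1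

lemma csupp_ae (Q : Measure E) [IsProbabilityMeasure Q] : ∀ᵐ x ∂Q, x ∈ csupp Q := by
  have : SecondCountableTopology E := by
    have : ProperSpace E := FiniteDimensional.proper ℝ E
    infer_instance
  obtain ⟨T, hTc, hTs, hTe⟩ := TopologicalSpace.isOpen_sUnion_countable
    (compl '' {C : Set E | IsClosed C ∧ Convex ℝ C ∧ Q C = 1})
    (by rintro _ ⟨C, hC, rfl⟩; exact hC.1.isOpen_compl)
  have h0 : Q (⋃₀ T) = 0 := by
    rw [measure_sUnion_null_iff hTc]
    intro s hs
    obtain ⟨C, hC, rfl⟩ := hTs hs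
    rw [prob_compl_eq_zero_iff hC.1.measurableSet]
    exact hC.2.2
  rw [hTe, ← compl_sInter] at h0
  exact h0

lemma small_vol {Q : Measure E} [IsProbabilityMeasure Q]
    (hint : (interior (csupp Q)).Nonempty) :
    ∃ δ : ℝ, 0 < δ ∧ ∃ η : ℝ, 0 < η ∧ ∀ C : Set E, Convex ℝ C → MeasurableSet C →
      volume C ≤ ENNReal.ofReal δ → ENNReal.ofReal η ≤ Q Cᶜ := by
  by_contra hcon
  push Not at hcon
  have hp : ∀ n : ℕ, (0:ℝ) < (1/2)^n := fun n => by positivity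
  choose C hC hm hv hq using fun n : ℕ => hcon ((1/2)^n) (hp n) ((1/2)^n) (hp n)
  have hsum : ∑' n, Q (C n)ᶜ ≠ ⊤ := by
    refine ne_top_of_le_ne_top (b := ENNReal.ofReal (∑' n : ℕ, (1/2:ℝ)^n)) (by simp) ?_
    rw [ENNReal.ofReal_tsum_of_nonneg (fun n => (hp n).le) summable_geometric_two]
    exact ENNReal.tsum_le_tsum fun n => (hq n).le
  have hae := ae_eventually_notMem hsum
  set D : Set E := {x | ∀ᶠ n in atTop, x ∈ C n} with hDdef
  have hDc : Convex ℝ D := by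
    intro x hx y hy a b ha hb hab
    filter_upwards [hx, hy] with n h1 h2
    exact hC n h1 h2 ha hb hab
  have hQD : Q D = 1 := by
    rw [← prob_compl_eq_zero_iff₀]
    · refine measure_mono_null ?_ (mem_ae_iff.1 hae)
      intro x hx hx'
      apply hx
      have h : ∀ᶠ n in atTop, x ∉ (C n)ᶜ := hx'
      exact h.mono fun n hn => by simpa using hn
    · apply MeasurableSet.nullMeasurableSet
      rw [hDdef]
      simp only [eventually_atTop]
      have : {x | ∃ a, ∀ b, a ≤ b → x ∈ C b} = ⋃ a, ⋂ b, ⋂ (_ : a ≤ b), C b := by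
        ext; simp
      rw [this]
      exact MeasurableSet.iUnion fun a => MeasurableSet.iInter fun b =>
        MeasurableSet.iInter fun _ => hm b
  have hvD : volume D = 0 := by
    have : D ⊆ ⋃ N : ℕ, {x | ∀ n, N ≤ n → x ∈ C n} := by
      intro x hx
      obtain ⟨N, hN⟩ := eventually_atTop.1 hx
      exact mem_iUnion.2 ⟨N, hN⟩
    refine measure_mono_null this (measure_iUnion_null fun N => ?_)
    have ht : Tendsto (fun n : ℕ => ENNReal.ofReal ((1/2:ℝ)^n)) atTop (𝓝 0) := by
      have := ENNReal.tendsto_ofReal (tendsto_pow_atTop_nhds_zero_of_lt_one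
        (r := (1/2:ℝ)) (by norm_num) (by norm_num))
      simpa using this
    apply le_antisymm _ bot_le
    refine ge_of_tendsto ht ?_
    filter_upwards [eventually_ge_atTop N] with n hn
    refine (measure_mono (t := C n) fun x hx => ?_).trans (hv n)
    have hx' : ∀ n, N ≤ n → x ∈ C n := hx
    exact hx' n hn
  have := hint.mono (interior_csupp_subset hint hDc hQD)
  exact (isOpen_interior.measure_pos volume this).ne' (measure_mono_null interior_subset hvD)

lemma bounded_of_vol {D : Set E} (hD : Convex ℝ D) {z : E} {r : ℝ} (hr : 0 < r)
    (hz : Metric.ball z r ⊆ D) (hv : volume D ≠ ⊤) : ∃ R : ℝ, ∀ x ∈ D, ‖x - z‖ ≤ R := by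
  set v := volume (Metric.ball (0:E) (r/2)) with hvdef
  have hv0 : v ≠ 0 := (Metric.measure_ball_pos volume _ (by positivity)).ne'
  obtain ⟨N, hN⟩ : ∃ N : ℕ, volume D < N * v := by
    obtain ⟨N, hN⟩ := ENNReal.exists_nat_mul_gt hv0 hv
    exact ⟨N, hN⟩
  have hNpos : 0 < N := by
    rcases Nat.eq_zero_or_pos N with h | h
    · subst h; simp at hN
    · exact h
  have hNr : (0:ℝ) < N := by exact_mod_cast hNpos
  refine ⟨2 * N * r, fun x hx => ?_⟩
  by_contra hcon
  push Not at hcon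
  set p : ℕ → E := fun k => z + ((k:ℝ) / (2 * N)) • (x - z) with hp
  have hsub : ∀ k ∈ Finset.range N, Metric.ball (p k) (r/2) ⊆ D := by
    intro k hk y hy
    have hkN : (k:ℝ) < N := by exact_mod_cast Finset.mem_range.1 hk
    set t : ℝ := (k:ℝ) / (2 * N) with ht
    have ht0 : 0 ≤ t := by positivity
    have ht1 : t ≤ 1/2 := by
      rw [ht, div_le_div_iff₀ (by positivity) (by norm_num)]; linarith
    have h1t : 0 < 1 - t := by linarith
    set w := y - p k with hw
    have hwn : ‖w‖ < r/2 := by rwa [Metric.mem_ball, dist_eq_norm] at hy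
    have hq : z + (1 - t)⁻¹ • w ∈ D := by
      apply hz
      rw [Metric.mem_ball, dist_eq_norm, add_sub_cancel_left, norm_smul, norm_inv,
        Real.norm_of_nonneg h1t.le]
      rw [inv_mul_lt_iff₀ h1t]
      nlinarith
    have := hD hq hx h1t.le ht0 (by ring)
    convert this using 1
    rw [smul_add, smul_smul, mul_inv_cancel₀ h1t.ne', hw, hp]
    simp only [← ht]
    module
  have hdisj : (↑(Finset.range N) : Set ℕ).PairwiseDisjoint (fun k => Metric.ball (p k) (r/2)) := by
    intro i _ j _ hij
    apply Metric.ball_disjoint_ball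
    have : p i - p j = (((i:ℝ) - j) / (2 * N)) • (x - z) := by
      simp only [hp]; module
    rw [dist_eq_norm, this, norm_smul, norm_div, Real.norm_of_nonneg (by positivity : 0 ≤ 2 * (N:ℝ)),
      div_mul_eq_mul_div, le_div_iff₀ (by positivity)]
    have h1 : 1 ≤ ‖(i:ℝ) - j‖ := by
      rw [Real.norm_eq_abs]
      have h : (1:ℤ) ≤ |(i:ℤ) - j| := Int.one_le_abs (sub_ne_zero.2 (by exact_mod_cast hij))
      exact_mod_cast h
    nlinarith [norm_nonneg (x - z)]
  have hle : volume (⋃ k ∈ Finset.range N, Metric.ball (p k) (r/2)) ≤ volume D :=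
    measure_mono (iUnion₂_subset hsub)
  rw [measure_biUnion_finset hdisj (fun _ _ => Metric.isOpen_ball.measurableSet)] at hle
  simp only [Measure.addHaar_ball_center volume, Finset.sum_const, Finset.card_range,
    nsmul_eq_mul] at hle
  exact absurd hle (not_le.2 hN)

lemma Conc.convex_level {φ : E → EReal} (h : Conc φ) (K : ℝ) :
    Convex ℝ {x | (K : EReal) ≤ φ x} := by
  rw [convex_iff_forall_pos]
  intro x hx y hy a b ha hb hab
  have := h x y a b ha hb hab K K hx hy
  rwa [← add_mul, hab, one_mul] at this

lemma Conc.convex_dom {φ : E → EReal} (h : Conc φ) : Convex ℝ {x | φ x ≠ ⊥} := by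
  rw [convex_iff_forall_pos]
  intro x hx y hy a b ha hb hab
  have key : ∀ {u : EReal}, u ≠ ⊥ → ∃ s : ℝ, (s : EReal) ≤ u := fun {u} hu => by
    obtain ⟨s, hs⟩ := EReal.lt_iff_exists_real_btwn.1 (bot_lt_iff_ne_bot.2 hu)
    exact ⟨s, hs.2.le⟩
  obtain ⟨s, hs⟩ := key hx
  obtain ⟨t, ht⟩ := key hy
  have := h x y a b ha hb hab s t hs ht
  intro hb
  rw [hb] at this
  exact EReal.coe_ne_bot _ (le_bot_iff.1 this)

lemma convex_interior_of_pos {D : Set E} (hD : Convex ℝ D) (hv : volume D ≠ 0) :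
    (interior D).Nonempty := by
  by_contra h
  rw [not_nonempty_iff_eq_empty] at h
  apply hv
  refine measure_mono_null ?_ (hD.addHaar_frontier volume)
  rw [frontier, h, sdiff_empty]
  exact subset_closure

lemma level_vol {φ : E → EReal} (hφ : Measurable φ) (K : ℝ) :
    ENNReal.ofReal (Real.exp K) * volume {x | (K : EReal) ≤ φ x} ≤ If φ := by
  have := mul_meas_ge_le_lintegral (μ := volume) hφ.ereal_exp (ENNReal.ofReal (Real.exp K))
  rw [← EReal.exp_coe] at this ⊢
  simp only [EReal.exp_le_exp_iff] at this
  exact this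

lemma coercive_of_int {φ : E → EReal} (hφ : Measurable φ) (h : Conc φ) (hI : If φ ≠ ⊤)
    {K : ℝ} (hK : volume {x | (K : EReal) ≤ φ x} ≠ 0) :
    Tendsto φ (Filter.comap (fun x : E => ‖x‖) atTop) (𝓝 ⊥) := by
  rw [coercive_iff]
  intro K'
  set D := {x | ((min K K' : ℝ) : EReal) ≤ φ x} with hDdef
  have hDc : Convex ℝ D := h.convex_level _
  have hsub : {x | (K : EReal) ≤ φ x} ⊆ D := fun x hx => by
    have hx' : (K : EReal) ≤ φ x := hx
    have : ((min K K' : ℝ) : EReal) ≤ φ x := le_trans (by exact_mod_cast min_le_left _ _) hx'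
    exact this
  obtain ⟨z, hz⟩ := convex_interior_of_pos hDc (fun h0 => hK (measure_mono_null hsub h0))
  obtain ⟨r, hr, hb⟩ := Metric.isOpen_iff.1 isOpen_interior z hz
  have hv : volume D ≠ ⊤ := by
    intro ht
    have := level_vol hφ (min K K')
    rw [← hDdef, ht, ENNReal.mul_top (by simpa using Real.exp_pos _)] at this
    exact hI (top_le_iff.1 this)
  obtain ⟨R, hR⟩ := bounded_of_vol hDc hr (hb.trans interior_subset) hv
  refine ⟨R + ‖z‖ + 1, fun x hx => ?_⟩
  by_contra hc
  have hxD : x ∈ D := by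
    refine le_trans ?_ (not_lt.1 hc)
    exact_mod_cast min_le_right _ _
  have h1 := hR x hxD
  have h2 := norm_sub_norm_le x z
  linarith

lemma dom_prop {Q : Measure E} [IsProbabilityMeasure Q] (hint : (interior (csupp Q)).Nonempty)
    {φ : E → EReal} (hφ : Measurable φ) (h : Conc φ) {M : ℝ} (hJ : Jf Q M φ ≠ ⊤) :
    interior (csupp Q) ⊆ interior {x | φ x ≠ ⊥} := by
  apply interior_csupp_subset hint h.convex_dom
  have := ae_ne_bot hφ hJ
  rw [← prob_compl_eq_zero_iff]
  · exact this
  · exact (hφ (measurableSet_singleton ⊥)).compl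

lemma If_pos {Q : Measure E} [IsProbabilityMeasure Q] (hint : (interior (csupp Q)).Nonempty)
    {φ : E → EReal} (hφ : Measurable φ) (h : Conc φ) {M : ℝ} (hJ : Jf Q M φ ≠ ⊤) :
    If φ ≠ 0 := by
  intro h0
  unfold If at h0
  rw [lintegral_eq_zero_iff hφ.ereal_exp] at h0
  have h1 := hint.mono (dom_prop hint hφ h hJ)
  refine (isOpen_interior.measure_pos volume h1).ne' (measure_mono_null interior_subset ?_)
  have h2 : ∀ᵐ x, φ x = ⊥ := by
    filter_upwards [h0] with x hx
    simpa using hx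
  exact h2

lemma max_bound {Q : Measure E} [IsProbabilityMeasure Q] (hint : (interior (csupp Q)).Nonempty) :
    ∃ M0 : ℝ, ∀ φ : E → EReal, IsPhi φ → If φ ≤ 1 → ∀ (x₀ : E) (M : ℝ), φ x₀ = M →
      M0 ≤ M → ENNReal.ofReal (2 * M) ≤ Jf Q M φ := by
  obtain ⟨δ, hδ, η, hη, H⟩ := small_vol hint
  set c : ℝ := 2 / η with hc
  have hc0 : 0 < c := by positivity
  set l : ℝ := 1 / (2 * (1 + c)) with hl
  have hl0 : 0 < l := by positivity
  have hl1 : l < 1 := by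
    rw [hl, div_lt_one (by positivity)]; linarith
  set d := Module.finrank ℝ E
  refine ⟨max 0 (2 * Real.log (1 / (l ^ d * δ))), fun φ hφ hI x₀ M hx₀ hM => ?_⟩
  have hM0 : 0 ≤ M := (le_max_left _ _).trans hM
  set C := {x | ((-(c * M) : ℝ) : EReal) ≤ φ x} with hC
  have hCm : MeasurableSet C := hφ.measurable measurableSet_Ici
  have hsub : AffineMap.homothety x₀ l '' C ⊆ {x | ((M/2 : ℝ) : EReal) ≤ φ x} := by
    rintro _ ⟨y, hy, rfl⟩
    have := hφ.conc x₀ y (1 - l) l (by linarith) hl0 (by ring) M (-(c*M)) hx₀.ge hy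
    have e : AffineMap.homothety x₀ l y = (1 - l) • x₀ + l • y := by
      rw [AffineMap.homothety_apply]; simp only [vsub_eq_sub, vadd_eq_add]; module
    rw [mem_ofPred_eq, e]
    refine le_trans (le_of_eq ?_) this
    congr 1
    rw [hl]; field_simp; ring
  have h1 : ENNReal.ofReal (Real.exp (M/2)) * (ENNReal.ofReal (l^d) * volume C) ≤ 1 := by
    have := Measure.addHaar_image_homothety volume x₀ l C
    rw [abs_of_pos (by positivity)] at this
    rw [← this]
    exact (mul_le_mul_right (measure_mono hsub) _).trans ((level_vol hφ.measurable _).trans hI)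
  have h2 : volume C ≤ ENNReal.ofReal δ := by
    have h3 : 1 / (l^d * δ) ≤ Real.exp (M/2) := by
      rw [← Real.log_le_iff_le_exp (by positivity)]
      have := (le_max_right _ _).trans hM
      linarith
    by_contra hcon
    push Not at hcon
    have h4 : ENNReal.ofReal (Real.exp (M/2)) * (ENNReal.ofReal (l^d) * ENNReal.ofReal δ) <
        ENNReal.ofReal (Real.exp (M/2)) * (ENNReal.ofReal (l^d) * volume C) := by
      rw [ENNReal.mul_lt_mul_iff_right (by simpa using Real.exp_pos _) (by simp),
        ENNReal.mul_lt_mul_iff_right (by simpa using pow_pos hl0 _) (by simp)]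
      exact hcon
    have h5 := h4.trans_le h1
    rw [← ENNReal.ofReal_mul (by positivity), ← ENNReal.ofReal_mul (by positivity),
      ENNReal.ofReal_lt_one] at h5
    rw [div_le_iff₀ (by positivity)] at h3
    linarith
  have h6 := H C (hφ.conc.convex_level _) hCm h2
  calc ENNReal.ofReal (2 * M) ≤ ENNReal.ofReal ((1 + c) * M) * ENNReal.ofReal η := by
        rw [← ENNReal.ofReal_mul (by positivity)]
        apply ENNReal.ofReal_le_ofReal
        have : c * η = 2 := by rw [hc]; field_simp
        nlinarith [mul_nonneg hη.le hM0]
    _ ≤ ENNReal.ofReal ((1 + c) * M) * Q Cᶜ := by gcongr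
    _ = ∫⁻ x in Cᶜ, ENNReal.ofReal ((1 + c) * M) ∂Q := by simp
    _ ≤ ∫⁻ x in Cᶜ, ((M : EReal) - φ x).toENNReal ∂Q := by
        apply setLIntegral_mono' hCm.compl
        intro x hx
        have hx' : φ x ≤ ((-(c * M) : ℝ) : EReal) := by
          have h7 : ¬ ((-(c * M) : ℝ) : EReal) ≤ φ x := hx
          exact (not_le.1 h7).le
        have := EReal.toENNReal_le_toENNReal (EReal.sub_le_sub (le_refl (M : EReal)) hx')
        refine le_trans (le_of_eq ?_) this
        rw [← EReal.coe_sub, EReal.toENNReal_of_ne_top (EReal.coe_ne_top _), EReal.toReal_coe]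
        congr 1; ring
    _ ≤ Jf Q M φ := setLIntegral_le_lintegral _ _

end convexgeom

open MeasureTheory Filter Topology Set
open scoped ENNReal RealInnerProductSpace BoundedContinuousFunction
set_option linter.unusedSectionVars false

section hull
variable {E : Type*} [NormedAddCommGroup E] [NormedSpace ℝ E]

/-- upper semicontinuous regularisation -/
noncomputable def uhull (f : E → EReal) (x : E) : EReal := limsup f (𝓝 x)

lemma uhull_usc (f : E → EReal) : UpperSemicontinuous (uhull f) := by
  intro x c hc
  obtain ⟨c', h1, h2⟩ := exists_between hc
  have h3 : ∀ᶠ y in 𝓝 x, f y < c' := eventually_lt_of_limsup_lt h1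
  filter_upwards [eventually_eventually_nhds.2 h3] with y hy
  exact (limsup_le_of_le (h := hy.mono fun _ h => h.le)).trans_lt h2

lemma le_uhull (f : E → EReal) (x : E) : f x ≤ uhull f x := by
  refine le_limsup_of_frequently_le ?_
  intro h
  exact h.self_of_nhds le_rfl

lemma uhull_le {f : E → EReal} {M : EReal} (h : ∀ x, f x ≤ M) (x : E) : uhull f x ≤ M :=
  limsup_le_of_le (h := Eventually.of_forall h)

lemma uhull_conc {f : E → EReal} (hf : Conc f) : Conc (uhull f) := by
  intro x y a b ha hb hab s t hs ht
  by_contra hcon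
  push Not at hcon
  obtain ⟨c, hc1, hc2⟩ := EReal.lt_iff_exists_real_btwn.1 hcon
  have hc2' : c < a * s + b * t := by exact_mod_cast hc2
  set ε := a * s + b * t - c with hε
  have hε0 : 0 < ε := by linarith
  have hz : ∀ᶠ z in 𝓝 (a • x + b • y), f z < c := eventually_lt_of_limsup_lt hc1
  have hcont : ContinuousAt (fun p : E × E => a • p.1 + b • p.2) (x, y) := by fun_prop
  have hev := hcont.eventually hz
  rw [nhds_prod_eq] at hev
  obtain ⟨pa, hpa, pb, hpb, hp⟩ := Filter.eventually_prod_iff.1 hev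
  have hs' : ((s - ε : ℝ) : EReal) < uhull f x :=
    lt_of_lt_of_le (by exact_mod_cast (by linarith : s - ε < s)) hs
  have ht' : ((t - ε : ℝ) : EReal) < uhull f y :=
    lt_of_lt_of_le (by exact_mod_cast (by linarith : t - ε < t)) ht
  obtain ⟨x', hx1, hx2⟩ := ((frequently_lt_of_lt_limsup (h := hs')).and_eventually hpa).exists
  obtain ⟨y', hy1, hy2⟩ := ((frequently_lt_of_lt_limsup (h := ht')).and_eventually hpb).exists
  have h1 := hf x' y' a b ha hb hab _ _ hx1.le hy1.le
  have h2 := hp hx2 hy2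
  have h3 := h1.trans_lt h2
  have h4 : a * (s - ε) + b * (t - ε) < c := by exact_mod_cast h3
  have h5 : a * (s - ε) + b * (t - ε) = c := by
    have : b = 1 - a := by linarith
    rw [hε]; subst this; ring
  linarith

lemma liminf_conc {φ : ℕ → E → EReal} (hφ : ∀ n, Conc (φ n)) :
    Conc (fun x => liminf (fun n => φ n x) atTop) := by
  intro x y a b ha hb hab s t hs ht
  by_contra hcon
  push Not at hcon
  obtain ⟨c, hc1, hc2⟩ := EReal.lt_iff_exists_real_btwn.1 hcon
  have hc2' : c < a * s + b * t := by exact_mod_cast hc2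
  set ε := a * s + b * t - c with hε
  have hε0 : 0 < ε := by linarith
  have hs' : ((s - ε : ℝ) : EReal) < liminf (fun n => φ n x) atTop :=
    lt_of_lt_of_le (by exact_mod_cast (by linarith : s - ε < s)) hs
  have ht' : ((t - ε : ℝ) : EReal) < liminf (fun n => φ n y) atTop :=
    lt_of_lt_of_le (by exact_mod_cast (by linarith : t - ε < t)) ht
  have h5 : a * (s - ε) + b * (t - ε) = c := by
    have : b = 1 - a := by linarith
    rw [hε]; subst this; ring
  refine absurd hc1 (not_lt.2 ?_)
  refine le_liminf_of_le (h := ?_)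
  filter_upwards [eventually_lt_of_lt_liminf hs', eventually_lt_of_lt_liminf ht'] with n h1 h2
  have := hφ n x y a b ha hb hab _ _ h1.le h2.le
  rwa [h5] at this

variable [MeasureSpace E] [BorelSpace E]
  [FiniteDimensional ℝ E] [(volume : Measure E).IsAddHaarMeasure]

lemma uhull_ae {f : E → EReal} (hf : Conc f) (htop : ∀ x, f x ≠ ⊤) :
    ∀ᵐ x, uhull f x = f x := by
  set D := {x | f x ≠ ⊥} with hD
  have hDc : Convex ℝ D := hf.convex_dom
  have h0 : ∀ᵐ x, x ∉ frontier D := by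
    have := hDc.addHaar_frontier volume
    rw [ae_iff]
    simpa using this
  filter_upwards [h0] with x hx
  by_cases hxi : x ∈ interior D
  · have hconc : ConcaveOn ℝ D (fun x => (f x).toReal) := by
      rw [concaveOn_iff_forall_pos]
      refine ⟨hDc, fun x hx y hy a b ha hb hab => ?_⟩
      have hz : f (a • x + b • y) ≠ ⊥ := hDc hx hy ha.le hb.le hab
      have h1 := hf x y a b ha hb hab (f x).toReal (f y).toReal
        (EReal.coe_toReal (htop x) hx).le (EReal.coe_toReal (htop y) hy).le
      rw [← EReal.coe_toReal (htop _) hz] at h1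
      simpa using EReal.coe_le_coe_iff.1 h1
    have hc : ContinuousAt (fun x => (f x).toReal) x :=
      (hconc.continuousOn_interior).continuousAt (isOpen_interior.mem_nhds hxi)
    have hc2 : Tendsto (fun x => (((f x).toReal : ℝ) : EReal)) (𝓝 x) (𝓝 (((f x).toReal : ℝ) : EReal)) :=
      (continuous_coe_real_ereal.tendsto _).comp hc
    have hev : (fun x => (((f x).toReal : ℝ) : EReal)) =ᶠ[𝓝 x] f := by
      filter_upwards [isOpen_interior.mem_nhds hxi] with y hy
      exact EReal.coe_toReal (htop y) (interior_subset hy)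
    have hc3 := hc2.congr' hev
    rw [EReal.coe_toReal (htop x) (interior_subset hxi)] at hc3
    exact hc3.limsup_eq
  · have hxc : x ∉ closure D := fun h => hx ⟨h, hxi⟩
    have hev : ∀ᶠ y in 𝓝 x, f y = ⊥ := by
      filter_upwards [isClosed_closure.isOpen_compl.mem_nhds hxc] with y hy
      by_contra hne
      exact hy (subset_closure hne)
    unfold uhull
    rw [limsup_congr hev, hev.self_of_nhds]
    exact limsup_const _

lemma limsup_le_usc {φ : ℕ → E → EReal} (hφ : ∀ n, Conc (φ n)) {ψ : E → EReal}
    (hψ : UpperSemicontinuous ψ) (hae : ∀ᵐ y, limsup (fun n => φ n y) atTop ≤ ψ y)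
    {A : Set E} (hA : volume A ≠ 0) {K : ℝ} (hK : ∀ z ∈ A, ∀ᶠ n in atTop, (K : EReal) ≤ φ n z)
    (x : E) : limsup (fun n => φ n x) atTop ≤ ψ x := by
  by_contra hcon
  push Not at hcon
  obtain ⟨s, hs1, hs2⟩ := EReal.lt_iff_exists_real_btwn.1 hcon
  obtain ⟨s', hs3, hs4⟩ := EReal.lt_iff_exists_real_btwn.1 hs1
  have hss : s' < s := by exact_mod_cast hs4
  have hfreq : ∃ᶠ n in atTop, (s : EReal) < φ n x := frequently_lt_of_lt_limsup (h := hs2)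
  obtain ⟨ε, hε, hball⟩ := Metric.eventually_nhds_iff_ball.1 (hψ x s' hs3)
  obtain ⟨R, hR⟩ : ∃ R : ℕ, volume (A ∩ Metric.ball x R) ≠ 0 := by
    by_contra h
    push Not at h
    apply hA
    have : A ⊆ ⋃ R : ℕ, A ∩ Metric.ball x R := by
      rw [← inter_iUnion, Metric.iUnion_ball_nat, inter_univ]
    exact measure_mono_null this (measure_iUnion_null h)
  obtain ⟨t, ht0, ht1, ht2, ht3⟩ : ∃ t : ℝ, 0 < t ∧ t < 1 ∧ t * R < ε ∧
      s' < (1 - t) * s + t * K := by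
    have h1 : ∀ᶠ t : ℝ in 𝓝 0, t < 1 := eventually_lt_nhds (by norm_num)
    have h2 : ∀ᶠ t : ℝ in 𝓝 0, t * R < ε := by
      have : ContinuousAt (fun t : ℝ => t * R) 0 := by fun_prop
      exact this.eventually_lt_const (by simpa using hε)
    have h3 : ∀ᶠ t : ℝ in 𝓝 0, s' < (1 - t) * s + t * K := by
      have : ContinuousAt (fun t : ℝ => (1 - t) * s + t * K) 0 := by fun_prop
      exact this.eventually_const_lt (by simpa using hss)
    obtain ⟨t, ht, ht'⟩ := (((h1.and (h2.and h3)).filter_mono nhdsWithin_le_nhds).and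
      (self_mem_nhdsWithin : Ioi (0:ℝ) ∈ 𝓝[>] 0)).exists
    exact ⟨t, ht', ht.1, ht.2.1, ht.2.2⟩
  set T := AffineMap.homothety x t '' (A ∩ Metric.ball x R) with hT
  have hTv : volume T ≠ 0 := by
    rw [hT, Measure.addHaar_image_homothety]
    refine mul_ne_zero ?_ hR
    simp only [ne_eq, ENNReal.ofReal_eq_zero, not_le]
    positivity
  obtain ⟨y, hyT, hy⟩ : ∃ y ∈ T, limsup (fun n => φ n y) atTop ≤ ψ y := by
    by_contra h
    push Not at h
    apply hTv
    refine measure_mono_null (fun y hy => ?_) (ae_iff.1 hae)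
    exact not_le.2 (h y hy)
  obtain ⟨z, ⟨hzA, hzR⟩, rfl⟩ := hyT
  have e : AffineMap.homothety x t z = (1 - t) • x + t • z := by
    rw [AffineMap.homothety_apply]; simp only [vsub_eq_sub, vadd_eq_add]; module
  rw [e] at hy
  have hmem : (1 - t) • x + t • z ∈ Metric.ball x ε := by
    rw [Metric.mem_ball, dist_eq_norm, show (1 - t) • x + t • z - x = t • (z - x) by module,
      norm_smul, Real.norm_of_nonneg ht0.le]
    rw [Metric.mem_ball, dist_eq_norm] at hzR
    nlinarith
  have hlt := hball _ hmem
  have hge : (s' : EReal) ≤ limsup (fun n => φ n ((1 - t) • x + t • z)) atTop := by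
    refine le_limsup_of_frequently_le ?_
    refine (hfreq.and_eventually (hK z hzA)).mono fun n hn => ?_
    refine le_trans ?_ (hφ n x z (1 - t) t (by linarith) ht0 (by ring) s K hn.1.le hn.2)
    exact_mod_cast ht3.le
  exact absurd (hge.trans hy) (not_le.2 hlt)

lemma exists_level {φ : E → EReal} (hφ : Measurable φ) (h : If φ ≠ 0) :
    ∃ K : ℝ, volume {x | (K : EReal) ≤ φ x} ≠ 0 := by
  by_contra hcon
  push Not at hcon
  apply h
  unfold If
  rw [lintegral_eq_zero_iff hφ.ereal_exp]
  have : ∀ᵐ x, ∀ n : ℕ, ¬ (((-(n:ℝ) : ℝ)) : EReal) ≤ φ x := by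
    rw [ae_all_iff]
    intro n
    rw [ae_iff]
    simpa using hcon (-(n:ℝ))
  filter_upwards [this] with x hx
  have : φ x = ⊥ := by
    rw [EReal.eq_bot_iff_forall_lt]
    intro y
    obtain ⟨n, hn⟩ := exists_nat_ge (-y)
    refine (not_le.1 (hx n)).trans_le ?_
    exact_mod_cast (by linarith : -(n:ℝ) ≤ y)
  simp [this]

/-- the candidate `-‖x‖` -/
noncomputable def candf (x : E) : EReal := ((-‖x‖ : ℝ) : EReal)

lemma candf_phi : IsPhi (candf : E → EReal) := by
  have htop : ∀ x : E, candf x ≠ ⊤ := fun x => EReal.coe_ne_top _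
  refine ⟨?_, htop, (conc_iff htop).1 ?_, coercive_iff.2 ?_⟩
  · apply Continuous.upperSemicontinuous
    exact continuous_coe_real_ereal.comp (by fun_prop)
  · intro x y a b ha hb hab s t hs ht
    unfold candf at *
    rw [EReal.coe_le_coe_iff] at *
    have := norm_add_le (a • x) (b • y)
    rw [norm_smul, norm_smul, Real.norm_of_nonneg ha.le, Real.norm_of_nonneg hb.le] at this
    nlinarith
  · intro K
    refine ⟨-K + 1, fun x hx => ?_⟩
    unfold candf
    rw [EReal.coe_lt_coe_iff]; linarith

lemma candf_If : If (candf : E → EReal) ≠ ⊤ := by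
  set r : ℕ := Module.finrank ℝ E + 1 with hr
  have hint : Integrable (fun x : E => (1 + ‖x‖) ^ (-(r:ℝ))) volume :=
    integrable_one_add_norm (by rw [hr]; push_cast; linarith)
  have h2 := (hint.const_mul (r.factorial * Real.exp 1)).lintegral_lt_top
  refine ne_top_of_le_ne_top h2.ne ?_
  unfold If
  apply lintegral_mono
  intro x
  simp only [candf, EReal.exp_coe]
  apply ENNReal.ofReal_le_ofReal
  have hp : 0 < 1 + ‖x‖ := by positivity
  rw [Real.rpow_neg hp.le, Real.rpow_natCast]
  have h3 := Real.pow_div_factorial_le_exp (1 + ‖x‖) hp.le r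
  have h4 : (0:ℝ) < r.factorial := by exact_mod_cast r.factorial_pos
  rw [div_le_iff₀ h4, Real.exp_add] at h3
  rw [Real.exp_neg, ← div_eq_mul_inv, le_div_iff₀ (by positivity), inv_mul_le_iff₀ (Real.exp_pos _)]
  linarith

lemma candf_Jf {Q : Measure E} (hmom : (∫⁻ x, (‖x‖₊ : ℝ≥0∞) ∂Q) ≠ ⊤) :
    Jf Q 0 (candf : E → EReal) ≠ ⊤ := by
  convert hmom using 1
  unfold Jf
  apply lintegral_congr
  intro x
  unfold candf
  rw [← EReal.coe_sub, EReal.toENNReal_of_ne_top (EReal.coe_ne_top _), EReal.toReal_coe]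
  simp
  rfl

end hull

open MeasureTheory Filter Topology Set
open scoped ENNReal RealInnerProductSpace BoundedContinuousFunction
set_option linter.unusedSectionVars false

section final
variable {E : Type*} [NormedAddCommGroup E] [NormedSpace ℝ E] [MeasureSpace E] [BorelSpace E]
  [FiniteDimensional ℝ E] [(volume : Measure E).IsAddHaarMeasure]

lemma normalize_phi {Q : Measure E} [IsProbabilityMeasure Q] (hint : (interior (csupp Q)).Nonempty)
    {φ : E → EReal} (hφ : IsPhi φ) (hL : Lfun φ Q ≠ ⊥) :
    ∃ φ' : E → EReal, ∃ v : ℝ, IsPhi φ' ∧ If φ' = 1 ∧ Lfun φ' Q = (v : EReal) ∧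
      Lfun φ Q ≤ v ∧ (Lfun φ Q = v → If φ = 1) := by
  obtain ⟨M, hM⟩ := hφ.exists_bound
  obtain ⟨hJ, hI⟩ := Lfun_ne_bot hφ.measurable hM hL
  have hI0 := If_pos hint hφ.measurable hφ.conc hJ
  set I := (If φ).toReal with hIdef
  have hIp : 0 < I := ENNReal.toReal_pos hI0 hI
  have hIe : If φ = ENNReal.ofReal I := (ENNReal.ofReal_toReal hI).symm
  set c := -Real.log I with hc
  have hec : Real.exp c = I⁻¹ := by rw [hc, Real.exp_neg, Real.exp_log hIp]
  have h1 : If (fun x => φ x + (c : EReal)) = 1 := by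
    rw [If_shift, hIe, hec, ← ENNReal.ofReal_mul (by positivity), inv_mul_cancel₀ hIp.ne']
    simp
  have hp := hφ.add_const c
  have hM' : ∀ x, φ x + (c : EReal) ≤ ((M + c : ℝ) : EReal) := fun x => by
    rw [EReal.coe_add]; exact add_le_add (hM x) le_rfl
  have hJ' := Jf_shift (Q := Q) (φ := φ) M c
  have h2 := Lfun_eq_real (Q := Q) hp.measurable hM' (by rw [hJ']; exact hJ) (by rw [h1]; simp)
  have h3 := Lfun_eq_real (Q := Q) hφ.measurable hM hJ hI
  rw [h1, hJ'] at h2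
  refine ⟨_, _, hp, h1, h2, ?_, ?_⟩
  · rw [h3, EReal.coe_le_coe_iff, ← hIdef]
    have := Real.log_le_sub_one_of_pos hIp
    simp only [ENNReal.toReal_one]
    linarith
  · rw [h3, EReal.coe_eq_coe_iff, ← hIdef]
    intro h
    simp only [ENNReal.toReal_one] at h
    have : I = 1 := by
      by_contra hne
      have := Real.log_lt_sub_one_of_pos hIp hne
      linarith
    rw [hIe, this]; simp

lemma unif_bound {Q : Measure E} [IsProbabilityMeasure Q] (hint : (interior (csupp Q)).Nonempty) :
    ∃ M0 : ℝ, ∀ (φ : E → EReal) (v : ℝ), IsPhi φ → If φ = 1 → Lfun φ Q = (v : EReal) →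
      v ≤ max M0 0 ∧ ∀ x, φ x ≤ ((max M0 (-v) : ℝ) : EReal) := by
  obtain ⟨M0, H⟩ := max_bound hint
  refine ⟨M0, fun φ v hφ hI hL => ?_⟩
  obtain ⟨x₀, hx₀⟩ := hφ.exists_max
  have hne : φ x₀ ≠ ⊥ := by
    intro hb
    have : If φ = 0 := by
      unfold If
      have : ∀ x, φ x = ⊥ := fun x => le_bot_iff.1 (hb ▸ hx₀ x)
      simp [this]
    rw [this] at hI; simp at hI
  obtain ⟨M, hM⟩ : ∃ M : ℝ, φ x₀ = M := ⟨_, (EReal.coe_toReal (hφ.2.1 x₀) hne).symm⟩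
  rw [hM] at hx₀
  obtain ⟨hJ, hI'⟩ := Lfun_ne_bot (Q := Q) hφ.measurable hx₀ (by rw [hL]; exact EReal.coe_ne_bot _)
  have h1 := Lfun_eq_real (Q := Q) hφ.measurable hx₀ hJ hI'
  rw [hL, hI, EReal.coe_eq_coe_iff] at h1
  simp only [ENNReal.toReal_one] at h1
  have hJ0 : 0 ≤ (Jf Q M φ).toReal := ENNReal.toReal_nonneg
  have h2 : M ≤ max M0 (-v) := by
    by_cases h : M0 ≤ M
    · have := H φ hφ hI.le x₀ M hM h
      rw [ENNReal.ofReal_le_iff_le_toReal hJ] at this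
      exact le_max_of_le_right (by linarith)
    · exact le_max_of_le_left (not_le.1 h).le
  refine ⟨?_, fun x => (hx₀ x).trans (by exact_mod_cast h2)⟩
  rcases le_max_iff.1 h2 with h | h
  · exact le_max_of_le_left (by linarith)
  · exact le_max_of_le_right (by linarith)

lemma mid_ineq {Q : Measure E} [IsProbabilityMeasure Q] {S : ℝ}
    (hS : ∀ φ : E → EReal, IsPhi φ → Lfun φ Q ≤ S) {φ φ' : E → EReal} {v v' : ℝ}
    (h : IsPhi φ) (hI : If φ = 1) (hv : Lfun φ Q = (v : EReal))
    (h' : IsPhi φ') (hI' : If φ' = 1) (hv' : Lfun φ' Q = (v' : EReal)) :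
    (∫⁻ x, ENNReal.ofReal ((hf φ x - hf φ' x) ^ 2)) ≤ ENNReal.ofReal (2 * S - v - v') := by
  obtain ⟨M1, hM1⟩ := h.exists_bound
  obtain ⟨M2, hM2⟩ := h'.exists_bound
  set M := max M1 M2
  have hM : ∀ x, φ x ≤ M := fun x => (hM1 x).trans (by exact_mod_cast le_max_left _ _)
  have hM' : ∀ x, φ' x ≤ M := fun x => (hM2 x).trans (by exact_mod_cast le_max_right _ _)
  have hm := h.mid h'
  have hMm : ∀ x, midf φ φ' x ≤ M := fun x => by
    unfold midf
    have h0 : (0 : EReal) ≤ ((1/2 : ℝ) : EReal) := by exact_mod_cast (by norm_num : (0:ℝ) ≤ 1/2)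
    refine (add_le_add (mul_le_mul_of_nonneg_left (hM x) h0)
      (mul_le_mul_of_nonneg_left (hM' x) h0)).trans (le_of_eq ?_)
    rw [← EReal.coe_mul, ← EReal.coe_add]; congr 1; ring
  obtain ⟨hJ, _⟩ := Lfun_ne_bot (Q := Q) h.measurable hM (by rw [hv]; exact EReal.coe_ne_bot _)
  obtain ⟨hJ', _⟩ := Lfun_ne_bot (Q := Q) h'.measurable hM' (by rw [hv']; exact EReal.coe_ne_bot _)
  have e1 := Lfun_eq_real (Q := Q) h.measurable hM hJ (by rw [hI]; simp)
  have e2 := Lfun_eq_real (Q := Q) h'.measurable hM' hJ' (by rw [hI']; simp)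
  rw [hv, hI, EReal.coe_eq_coe_iff] at e1
  rw [hv', hI', EReal.coe_eq_coe_iff] at e2
  simp only [ENNReal.toReal_one] at e1 e2
  have eJ := Jf_mid (Q := Q) h.measurable hM hM'
  have hJm : Jf Q M (midf φ φ') ≠ ⊤ := by
    intro ht
    rw [ht] at eJ
    have : Jf Q M φ + Jf Q M φ' ≠ ⊤ := ENNReal.add_ne_top.2 ⟨hJ, hJ'⟩
    exact this (by rw [← eJ]; simp)
  have eI := If_mid h.measurable h'.measurable h.2.1 h'.2.1
  rw [hI, hI'] at eI
  set X := ∫⁻ x, ENNReal.ofReal ((hf φ x - hf φ' x) ^ 2)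
  have hXI : X ≠ ⊤ ∧ 2 * If (midf φ φ') ≠ ⊤ := by
    rw [← ENNReal.add_ne_top, eI]; simp
  have hIm : If (midf φ φ') ≠ ⊤ := by
    intro ht
    apply hXI.2
    rw [ht]; simp
  have e3 := Lfun_eq_real (Q := Q) hm.measurable hMm hJm hIm
  have e4 := hS _ hm
  rw [e3, EReal.coe_le_coe_iff] at e4
  have eJ' := congrArg ENNReal.toReal eJ
  rw [ENNReal.toReal_mul, ENNReal.toReal_add hJ hJ'] at eJ'
  have eI' := congrArg ENNReal.toReal eI
  rw [ENNReal.toReal_add hXI.1 hXI.2, ENNReal.toReal_mul] at eI'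
  norm_num at eI' eJ'
  rw [ENNReal.le_ofReal_iff_toReal_le hXI.1]
  · linarith
  · have : 0 ≤ X.toReal := ENNReal.toReal_nonneg
    linarith

lemma hf_sq {φ : E → EReal} {x : E} (h : φ x ≠ ⊤) :
    ENNReal.ofReal (hf φ x ^ 2) = EReal.exp (φ x) := by
  unfold hf
  rw [Real.sq_sqrt ENNReal.toReal_nonneg, ENNReal.ofReal_toReal]
  simpa using h

lemma unique_aux {Q : Measure E} [IsProbabilityMeasure Q] {S : ℝ}
    (hS : ∀ φ : E → EReal, IsPhi φ → Lfun φ Q ≤ S) {φ φ' : E → EReal} 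
    (h : IsPhi φ) (hI : If φ = 1) (hv : Lfun φ Q = (S : EReal))
    (h' : IsPhi φ') (hI' : If φ' = 1) (hv' : Lfun φ' Q = (S : EReal)) : φ = φ' := by
  have h1 := mid_ineq hS h hI hv h' hI' hv'
  have h2 : (∫⁻ x, ENNReal.ofReal ((hf φ x - hf φ' x) ^ 2)) = 0 := by
    apply le_antisymm _ bot_le
    refine h1.trans (le_of_eq ?_)
    rw [show 2 * S - S - S = 0 by ring]; simp
  rw [lintegral_eq_zero_iff (by
      have := hf_meas h.measurable
      have := hf_meas h'.measurable
      fun_prop)] at h2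
  have hae : ∀ᵐ x, φ x = φ' x := by
    filter_upwards [h2] with x hx
    have h3 : (hf φ x - hf φ' x) ^ 2 = 0 :=
      le_antisymm (by simpa using hx) (sq_nonneg _)
    have h4 : hf φ x = hf φ' x := by
      rw [sq_eq_zero_iff] at h3; linarith
    have h5 := hf_sq (h.2.1 x)
    rw [h4, hf_sq (h'.2.1 x)] at h5
    exact (EReal.exp_strictMono.injective h5).symm
  have key : ∀ {φ φ' : E → EReal}, IsPhi φ → IsPhi φ' → If φ = 1 → (∀ᵐ x, φ x = φ' x) →
      ∀ x, φ x ≤ φ' x := by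
    intro φ φ' h h' hI hae x
    obtain ⟨K, hK⟩ := exists_level h.measurable (by rw [hI]; simp)
    have := limsup_le_usc (φ := fun _ : ℕ => φ) (fun _ => h.conc) h'.1
      (by filter_upwards [hae] with y hy; simp [hy]) hK (K := K)
      (fun z hz => Eventually.of_forall fun _ => hz) x
    simpa using this
  funext x
  exact le_antisymm (key h h' hI hae x) (key h' h hI' (hae.mono fun x hx => hx.symm) x)

lemma exists_limit {Q : Measure E} [IsProbabilityMeasure Q] {S M : ℝ}
    (hS : ∀ φ : E → EReal, IsPhi φ → Lfun φ Q ≤ S) {φ : ℕ → E → EReal} {v : ℕ → ℝ}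
    (h : ∀ n, IsPhi (φ n)) (hI : ∀ n, If (φ n) = 1) (hv : ∀ n, Lfun (φ n) Q = (v n : EReal))
    (hM : ∀ n x, φ n x ≤ M) (hvn : ∀ n, S - (1/4)^n / 8 ≤ v n) :
    ∃ ψ : E → EReal, IsPhi ψ ∧ S ≤ Lfun ψ Q := by
  have hvS : ∀ n, v n ≤ S := fun n => by
    have := hS _ (h n)
    rw [hv n] at this
    exact_mod_cast this
  have hmid : ∀ N n m, N ≤ n → N ≤ m →
      (∫⁻ x, ENNReal.ofReal ((hf (φ n) x - hf (φ m) x) ^ 2)) ≤ ENNReal.ofReal ((1/4)^N / 4) := by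
    intro N n m hn hm
    refine (mid_ineq hS (h n) (hI n) (hv n) (h m) (hI m) (hv m)).trans
      (ENNReal.ofReal_le_ofReal ?_)
    have h1 : (1/4:ℝ)^n ≤ (1/4)^N := pow_le_pow_of_le_one (by norm_num) (by norm_num) hn
    have h2 : (1/4:ℝ)^m ≤ (1/4)^N := pow_le_pow_of_le_one (by norm_num) (by norm_num) hm
    have := hvn n
    have := hvn m
    linarith
  -- a.e. convergence of the roots
  have hconv : ∀ᵐ x, ∃ l : ℝ, Tendsto (fun n => hf (φ n) x) atTop (𝓝 l) := by
    refine MeasureTheory.Lp.ae_tendsto_of_cauchy_eLpNorm (p := 2) (μ := volume) (f := fun n => hf (φ n))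
      (fun n => (hf_meas (h n).measurable).aestronglyMeasurable) (by norm_num)
      (B := fun N => ENNReal.ofReal ((1/2)^N)) ?_ ?_
    · rw [← ENNReal.ofReal_tsum_of_nonneg (fun n => by positivity) summable_geometric_two]
      simp
    · intro N n m hn hm
      have h1 := hmid N n m hn hm
      have h2 : eLpNorm (hf (φ n) - hf (φ m)) 2 volume ^ 2 ≤ ENNReal.ofReal ((1/2)^N / 2) ^ 2 := by
        have e := eLpNorm_nnreal_pow_eq_lintegral (p := 2) (μ := volume)
          (f := hf (φ n) - hf (φ m)) (by norm_num)
        have e' : eLpNorm (hf (φ n) - hf (φ m)) 2 volume ^ 2 =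
            ∫⁻ x, ENNReal.ofReal ((hf (φ n) x - hf (φ m) x) ^ 2) := by
          have e2 : ∀ a : ℝ≥0∞, a ^ ((2 : NNReal) : ℝ) = a ^ 2 := fun a => by
            rw [← ENNReal.rpow_natCast]; norm_num
          simp only [e2] at e
          refine Eq.trans e (lintegral_congr fun x => ?_)
          rw [Real.enorm_eq_ofReal_abs, ← ENNReal.ofReal_pow (abs_nonneg _), sq_abs]
          rfl
        rw [e']
        refine h1.trans (le_of_eq ?_)
        rw [← ENNReal.ofReal_pow (by positivity)]
        congr 1
        have e4 : (1/4 : ℝ)^N = ((1/2)^N)^2 := by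
          rw [← pow_mul, mul_comm N 2, pow_mul]; norm_num
        rw [e4]; ring
      have h3 : eLpNorm (hf (φ n) - hf (φ m)) 2 volume ≤ ENNReal.ofReal ((1/2)^N / 2) := by
        by_contra hc
        push Not at hc
        exact absurd h2 (not_le.2 (ENNReal.pow_lt_pow_left (by norm_num) hc))
      refine h3.trans_lt ?_
      rw [ENNReal.ofReal_lt_ofReal_iff (by positivity)]
      have : (0:ℝ) < (1/2)^N := by positivity
      linarith
  set ell : E → EReal := fun x => liminf (fun n => φ n x) atTop with hell
  have hlim : ∀ᵐ x, Tendsto (fun n => φ n x) atTop (𝓝 (ell x)) := by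
    filter_upwards [hconv] with x hx
    obtain ⟨l, hl⟩ := hx
    have h1 : Tendsto (fun n => ENNReal.log (ENNReal.ofReal (hf (φ n) x ^ 2))) atTop
        (𝓝 (ENNReal.log (ENNReal.ofReal (l ^ 2)))) :=
      (ENNReal.continuous_log.tendsto _).comp (ENNReal.tendsto_ofReal (hl.pow 2))
    have h2 : (fun n => ENNReal.log (ENNReal.ofReal (hf (φ n) x ^ 2))) = fun n => φ n x := by
      funext n
      rw [hf_sq ((h n).2.1 x), EReal.log_exp]
    rw [h2] at h1
    rw [hell]
    simp only
    rw [h1.liminf_eq]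
    exact h1
  have hellc : Conc ell := liminf_conc fun n => (h n).conc
  have hellM : ∀ x, ell x ≤ M := fun x => by
    refine liminf_le_of_le (h := ?_)
    intro b hb
    obtain ⟨n, hn⟩ := hb.exists
    exact hn.trans (hM n x)
  have hell_top : ∀ x, ell x ≠ ⊤ := fun x hx => by
    have := hellM x
    rw [hx] at this
    exact EReal.coe_ne_top _ (top_le_iff.1 this)
  set ψ := uhull ell with hψ
  have hψae : ∀ᵐ x, ψ x = ell x := uhull_ae hellc hell_top
  have hψusc : UpperSemicontinuous ψ := uhull_usc _
  have hψc : Conc ψ := uhull_conc hellc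
  have hψM : ∀ x, ψ x ≤ M := uhull_le hellM
  have hψtop : ∀ x, ψ x ≠ ⊤ := fun x hx => by
    have := hψM x
    rw [hx] at this
    exact EReal.coe_ne_top _ (top_le_iff.1 this)
  have hψm : Measurable ψ := hψusc.measurable
  have hψI : If ψ ≤ 1 := by
    calc If ψ = ∫⁻ x, liminf (fun n => EReal.exp (φ n x)) atTop := by
          apply lintegral_congr_ae
          filter_upwards [hψae, hlim] with x h1 h2
          rw [h1]
          exact (((ENNReal.continuous_exp.tendsto _).comp h2).liminf_eq).symm
      _ ≤ liminf (fun n => ∫⁻ x, EReal.exp (φ n x)) atTop :=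
          lintegral_liminf_le fun n => (h n).measurable.ereal_exp
      _ = 1 := by
          have : (fun n => ∫⁻ x, EReal.exp (φ n x)) = fun _ => 1 := funext hI
          rw [this]; simp
  -- nondegeneracy
  obtain ⟨K, hK⟩ : ∃ K : ℕ, volume {z | ∀ᶠ n in atTop, ((-(K:ℝ) : ℝ) : EReal) ≤ φ n z} ≠ 0 := by
    by_contra hcon
    push Not at hcon
    have h1 : ∀ᵐ z, ∀ K : ℕ, ¬ ∀ᶠ n in atTop, ((-(K:ℝ) : ℝ) : EReal) ≤ φ n z := by
      rw [ae_all_iff]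
      intro K
      rw [ae_iff]
      simpa only [not_not] using hcon K
    have h2 : ∀ᵐ z, Tendsto (fun n => hf (φ n) z) atTop (𝓝 0) := by
      filter_upwards [h1, hlim] with z hz hz2
      have h3 : ell z = ⊥ := by
        rw [EReal.eq_bot_iff_forall_lt]
        intro y
        by_contra hc
        obtain ⟨K, hK⟩ := exists_nat_gt (-y)
        apply hz K
        have : ((-(K:ℝ) : ℝ) : EReal) < ell z := by
          refine lt_of_lt_of_le ?_ (not_lt.1 hc)
          exact_mod_cast (by linarith : -(K:ℝ) < y)
        exact (eventually_lt_of_lt_liminf this).mono fun n hn => hn.le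
      rw [h3] at hz2
      have h4 := (ENNReal.continuous_exp.tendsto _).comp hz2
      rw [EReal.exp_bot] at h4
      have h5 := (ENNReal.tendsto_toReal (by simp)).comp h4
      have h6 := (Real.continuous_sqrt.tendsto _).comp h5
      rw [ENNReal.toReal_zero, Real.sqrt_zero] at h6
      exact h6
    have h7 : (1 : ℝ≥0∞) ≤ ENNReal.ofReal ((1/4)^0 / 4) := by
      calc (1 : ℝ≥0∞) = ∫⁻ x, EReal.exp (φ 0 x) := (hI 0).symm
        _ = ∫⁻ x, liminf (fun m => ENNReal.ofReal ((hf (φ 0) x - hf (φ m) x) ^ 2)) atTop := by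
            apply lintegral_congr_ae
            filter_upwards [h2] with x hx
            have := ENNReal.tendsto_ofReal ((hx.const_sub (hf (φ 0) x)).pow 2)
            rw [this.liminf_eq, sub_zero, hf_sq ((h 0).2.1 x)]
        _ ≤ liminf (fun m => ∫⁻ x, ENNReal.ofReal ((hf (φ 0) x - hf (φ m) x) ^ 2)) atTop := by
            apply lintegral_liminf_le
            intro m
            have := hf_meas (h 0).measurable
            have := hf_meas (h m).measurable
            fun_prop
        _ ≤ liminf (fun m : ℕ => ENNReal.ofReal ((1/4)^0 / 4)) atTop := by
            refine liminf_le_liminf ?_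
            exact Eventually.of_forall fun m => hmid 0 0 m le_rfl (Nat.zero_le _)
        _ = _ := by simp
    rw [← ENNReal.ofReal_one, ENNReal.ofReal_le_ofReal_iff (by norm_num)] at h7
    norm_num at h7
  have hlevel : volume {x | ((-(K:ℝ) : ℝ) : EReal) ≤ ψ x} ≠ 0 := by
    intro h0
    apply hK
    refine measure_mono_null (fun z hz => ?_) h0
    have hz' : ∀ᶠ n in atTop, ((-(K:ℝ) : ℝ) : EReal) ≤ φ n z := hz
    have h1 : ((-(K:ℝ) : ℝ) : EReal) ≤ ell z := le_liminf_of_le (h := hz')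
    exact h1.trans (le_uhull ell z)
  have hψphi : IsPhi ψ := ⟨hψusc, hψtop, (conc_iff hψtop).1 hψc,
    coercive_of_int hψm hψc (ne_top_of_le_ne_top (by simp) hψI) hlevel⟩
  refine ⟨ψ, hψphi, ?_⟩
  have hsup : ∀ x, limsup (fun n => φ n x) atTop ≤ ψ x := by
    refine limsup_le_usc (fun n => (h n).conc) hψusc ?_ hK (K := -(K:ℝ)) (fun z hz => hz)
    filter_upwards [hlim, hψae] with y h1 h2
    rw [h1.limsup_eq, h2]
  have hJn : ∀ n, Jf Q M (φ n) = ENNReal.ofReal (M - v n) := by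
    intro n
    obtain ⟨hJ, _⟩ := Lfun_ne_bot (Q := Q) (h n).measurable (hM n)
      (by rw [hv n]; exact EReal.coe_ne_bot _)
    have e1 := Lfun_eq_real (Q := Q) (h n).measurable (hM n) hJ (by rw [hI n]; simp)
    rw [hv n, hI n, EReal.coe_eq_coe_iff] at e1
    simp only [ENNReal.toReal_one] at e1
    rw [← ENNReal.ofReal_toReal hJ]
    congr 1; linarith
  have hvlim : Tendsto v atTop (𝓝 S) := by
    have h1 : Tendsto (fun n : ℕ => S - (1/4:ℝ)^n / 8) atTop (𝓝 S) := by
      have := (tendsto_pow_atTop_nhds_zero_of_lt_one (r := (1/4:ℝ)) (by norm_num)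
        (by norm_num)).div_const 8
      simpa using this.const_sub S
    exact tendsto_of_tendsto_of_tendsto_of_le_of_le h1 tendsto_const_nhds hvn hvS
  have hJψ : Jf Q M ψ ≤ ENNReal.ofReal (M - S) := by
    calc Jf Q M ψ ≤ ∫⁻ x, liminf (fun n => ((M : EReal) - φ n x).toENNReal) atTop ∂Q := by
          apply lintegral_mono
          intro x
          have hanti : Antitone (fun u : EReal => ((M : EReal) - u).toENNReal) := fun u v huv =>
            EReal.toENNReal_le_toENNReal (EReal.sub_le_sub le_rfl huv)
          have hcont : Continuous (fun u : EReal => (M : EReal) - u) := by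
            rw [continuous_iff_continuousAt]
            intro u
            exact (EReal.continuousAt_add (p := ((M : EReal), -u)) (by simp) (by simp)).comp
              (f := fun u : EReal => ((M : EReal), -u)) (by fun_prop)
          have := hanti.map_limsup_of_continuousAt (F := atTop) (fun n => φ n x)
            (EReal.continuous_toENNReal.comp hcont).continuousAt
          refine (hanti (hsup x)).trans (le_of_eq ?_)
          exact this
      _ ≤ liminf (fun n => Jf Q M (φ n)) atTop :=
          lintegral_liminf_le fun n => (meas_sub M).comp (h n).measurable
      _ = ENNReal.ofReal (M - S) := by
          simp only [hJn]
          exact (ENNReal.tendsto_ofReal (hvlim.const_sub M)).liminf_eq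
  have hMS : S ≤ M := by
    refine le_of_tendsto hvlim (Eventually.of_forall fun n => ?_)
    obtain ⟨hJ, _⟩ := Lfun_ne_bot (Q := Q) (h n).measurable (hM n)
      (by rw [hv n]; exact EReal.coe_ne_bot _)
    have e1 := Lfun_eq_real (Q := Q) (h n).measurable (hM n) hJ (by rw [hI n]; simp)
    rw [hv n, hI n, EReal.coe_eq_coe_iff] at e1
    simp only [ENNReal.toReal_one] at e1
    have : 0 ≤ (Jf Q M (φ n)).toReal := ENNReal.toReal_nonneg
    linarith
  rw [Lfun_eq_real hψm hψM (ne_top_of_le_ne_top (by simp) hJψ)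
    (ne_top_of_le_ne_top (by simp) hψI), EReal.coe_le_coe_iff]
  have h1 := ENNReal.toReal_mono (by simp) hJψ
  have h2 := ENNReal.toReal_mono (by simp) hψI
  rw [ENNReal.toReal_ofReal (by linarith)] at h1
  simp only [ENNReal.toReal_one] at h2
  linarith

theorem main_aux (Q : Measure E) [IsProbabilityMeasure Q]
    (hmom : (∫⁻ x, (‖x‖₊ : ℝ≥0∞) ∂Q) ≠ ⊤) (hint : (interior (csupp Q)).Nonempty) :
    ∃ ψ : E → EReal, IsMLE Q ψ ∧
      (∫⁻ x, EReal.exp (ψ x)) = 1 ∧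
      interior (csupp Q) ⊆ {x | ψ x ≠ ⊥} ∧ {x | ψ x ≠ ⊥} ⊆ csupp Q ∧
      ∀ ψ' : E → EReal, IsMLE Q ψ' → ψ' = ψ := by
  obtain ⟨M0, hM0⟩ := unif_bound hint
  set V : Set ℝ := {v | ∃ φ : E → EReal, IsPhi φ ∧ If φ = 1 ∧ Lfun φ Q = (v : EReal)} with hV
  have hVne : V.Nonempty := by
    have hp : IsPhi (candf : E → EReal) := candf_phi
    have hb : ∀ x : E, candf x ≤ ((0:ℝ) : EReal) := fun x => by
      unfold candf
      rw [EReal.coe_le_coe_iff]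
      simp
    have h1 := Lfun_eq_real (Q := Q) hp.measurable hb (candf_Jf hmom) candf_If
    obtain ⟨φ', v, h2, h3, h4, _⟩ := normalize_phi hint hp (by rw [h1]; exact EReal.coe_ne_bot _)
    exact ⟨v, φ', h2, h3, h4⟩
  have hVb : BddAbove V := ⟨max M0 0, by
    rintro v ⟨φ, h1, h2, h3⟩
    exact (hM0 φ v h1 h2 h3).1⟩
  set S := sSup V with hSdef
  have hS : ∀ φ : E → EReal, IsPhi φ → Lfun φ Q ≤ S := by
    intro φ hφ
    by_cases hb : Lfun φ Q = ⊥
    · rw [hb]; exact bot_le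
    obtain ⟨φ', v, h1, h2, h3, h4, _⟩ := normalize_phi hint hφ hb
    refine h4.trans ?_
    exact_mod_cast le_csSup hVb ⟨φ', h1, h2, h3⟩
  have hex : ∀ n : ℕ, ∃ φ : E → EReal, ∃ v : ℝ, (IsPhi φ ∧ If φ = 1 ∧ Lfun φ Q = (v : EReal)) ∧
      S - (1/4)^n / 8 ≤ v := by
    intro n
    obtain ⟨v, ⟨φ, hφ⟩, hv⟩ := exists_lt_of_lt_csSup hVne
      (show S - (1/4)^n / 8 < sSup V by
        have : (0:ℝ) < (1/4)^n / 8 := by positivity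
        linarith)
    exact ⟨φ, v, hφ, hv.le⟩
  choose φ v hφ hv using hex
  obtain ⟨ψ, hψ, hψS⟩ := exists_limit (M := max M0 (-(S - 1))) hS (fun n => (hφ n).1)
    (fun n => (hφ n).2.1) (fun n => (hφ n).2.2) (fun n x => by
      refine ((hM0 _ _ (hφ n).1 (hφ n).2.1 (hφ n).2.2).2 x).trans ?_
      rw [EReal.coe_le_coe_iff]
      apply max_le_max le_rfl
      have h1 := hv n
      have h2 : (1/4:ℝ)^n ≤ 1 := pow_le_one₀ (by norm_num) (by norm_num)
      linarith) hv
  have hψL : Lfun ψ Q = S := le_antisymm (hS ψ hψ) hψS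
  have hone : ∀ φ : E → EReal, IsPhi φ → Lfun φ Q = S → If φ = 1 := by
    intro φ hφ hL
    obtain ⟨φ', w, h1, h2, h3, h4, h5⟩ := normalize_phi hint hφ (by rw [hL]; exact EReal.coe_ne_bot _)
    refine h5 (le_antisymm h4 ?_)
    rw [hL, ← h3]
    exact hS _ h1
  have huniq : ∀ φ : E → EReal, IsPhi φ → Lfun φ Q = S → φ = ψ := fun φ hφ hL =>
    unique_aux hS hφ (hone φ hφ hL) hL hψ (hone ψ hψ hψL) hψL
  obtain ⟨M, hM⟩ := hψ.exists_bound
  obtain ⟨hJ, hI⟩ := Lfun_ne_bot (Q := Q) hψ.measurable hM (by rw [hψL]; exact EReal.coe_ne_bot _)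
  refine ⟨ψ, ⟨hψ, fun φ hφ => hψL ▸ hS φ hφ⟩, hone ψ hψ hψL, ?_, ?_, ?_⟩
  · exact (dom_prop hint hψ.measurable hψ.conc hJ).trans interior_subset
  · have ht := hψ.trunc (csupp_closed Q) (csupp_convex Q)
    have hle : ∀ x, truncf (csupp Q) ψ x ≤ ψ x := fun x => by unfold truncf; split_ifs <;> simp
    have hJt : Jf Q M (truncf (csupp Q) ψ) = Jf Q M ψ := by
      apply lintegral_congr_ae
      filter_upwards [csupp_ae Q] with x hx
      simp [truncf, hx]
    have hIt : If (truncf (csupp Q) ψ) ≤ If ψ :=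
      lintegral_mono fun x => EReal.exp_monotone (hle x)
    have hItop := ne_top_of_le_ne_top hI hIt
    have e1 := Lfun_eq_real (Q := Q) ht.measurable (fun x => (hle x).trans (hM x))
      (by rw [hJt]; exact hJ) hItop
    have e2 := Lfun_eq_real (Q := Q) hψ.measurable hM hJ hI
    have h3 := ENNReal.toReal_mono hI hIt
    have h4 : Lfun (truncf (csupp Q) ψ) Q = S := by
      apply le_antisymm (hS _ ht)
      rw [← hψL, e1, e2, hJt, EReal.coe_le_coe_iff]
      linarith
    have h5 := huniq _ ht h4
    intro x hx
    by_contra hc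
    apply hx
    rw [← h5]
    simp [truncf, hc]
  · intro ψ' hψ'
    exact huniq ψ' hψ'.1 (le_antisymm (hS _ hψ'.1) (hψL ▸ hψ'.2 ψ hψ))

end final

/-- **Theorem 1 (existence and uniqueness).** If `Q` has finite first moment and `csupp Q`
has nonempty interior, there is a unique `ψ = ψ(·|Q) ∈ Φ(d)` maximizing `L(·, Q)`;
it satisfies `∫ e^{ψ} dx = 1` and `interior (csupp Q) ⊆ dom ψ ⊆ csupp Q`. -/
theorem exists_unique_MLE {d : ℕ}
    (Q : Measure (EuclideanSpace ℝ (Fin d))) [IsProbabilityMeasure Q]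
    (hmom : (∫⁻ x, (‖x‖₊ : ℝ≥0∞) ∂Q) ≠ ⊤) (hint : (interior (csupp Q)).Nonempty) :
    ∃ ψ : EuclideanSpace ℝ (Fin d) → EReal, IsMLE Q ψ ∧
      (∫⁻ x, EReal.exp (ψ x)) = 1 ∧
      interior (csupp Q) ⊆ {x | ψ x ≠ ⊥} ∧ {x | ψ x ≠ ⊥} ⊆ csupp Q ∧
      ∀ ψ' : EuclideanSpace ℝ (Fin d) → EReal, IsMLE Q ψ' → ψ' = ψ := by
  exact main_aux Q hmom hint
end

section
/- Let Q be a probability distribution on ℝ^d with ∫ ‖x‖ Q(dx) < ∞ and csupp(Q) having nonempty interior, let ψ = ψ(·|Q) be the unique maximizer of L(·, Q) over Φ(d), and let P be the probability measure with Lebesgue density e^{ψ(x)}. Then ∫ h dP ≤ ∫ h dQ for every convex function h : ℝ^d → (−∞, ∞], and the first moments agree: ∫ x P(dx) = ∫ x Q(dx). -/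
open MeasureTheory Filter Topology Set
open scoped ENNReal RealInnerProductSpace BoundedContinuousFunction

/-- Convexity of extended-real-valued functions, as in the statement. -/
def EConv {E : Type*} [NormedAddCommGroup E] [NormedSpace ℝ E] (h : E → EReal) : Prop :=
  ∀ x y : E, ∀ a b : ℝ, 0 < a → 0 < b → a + b = 1 →
        h (a • x + b • y) ≤ (a : EReal) * h x + (b : EReal) * h y

lemma EConv.convexOn {E : Type*} [NormedAddCommGroup E] [NormedSpace ℝ E] {h : E → EReal}
    (hb : ∀ x, h x ≠ ⊥) (hc : EConv h) : ConvexOn ℝ {x | h x ≠ ⊤} (fun x => (h x).toReal) := by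
  have key : ∀ x y : E, ∀ a b : ℝ, 0 < a → 0 < b → a + b = 1 → h x ≠ ⊤ → h y ≠ ⊤ →
      h (a • x + b • y) ≤ ((a * (h x).toReal + b * (h y).toReal : ℝ) : EReal) := by
    intro x y a b ha hb' hab hx hy
    have := hc x y a b ha hb' hab
    rw [← EReal.coe_toReal hx (hb x), ← EReal.coe_toReal hy (hb y)] at this
    exact_mod_cast this
  refine convexOn_iff_forall_pos.2 ⟨convex_iff_forall_pos.2 ?_, ?_⟩
  · intro x hx y hy a b ha hb' hab
    exact ne_top_of_le_ne_top (EReal.coe_ne_top _) (key x y a b ha hb' hab hx hy)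
  · intro x hx y hy a b ha hb' hab
    have := key x y a b ha hb' hab hx hy
    simp only [smul_eq_mul]
    have h2 := EReal.toReal_le_toReal this (hb _) (EReal.coe_ne_top _)
    rwa [EReal.toReal_coe] at h2

/-- Exact affine support at an interior point of the domain. -/
lemma EConv.exists_support {E : Type*} [NormedAddCommGroup E] [NormedSpace ℝ E]
    [FiniteDimensional ℝ E] {h : E → EReal}
    (hb : ∀ x, h x ≠ ⊥) (hc : EConv h) {x : E} (hx : x ∈ interior {x | h x ≠ ⊤}) :
    ∃ (f : E →L[ℝ] ℝ) (c : ℝ), (∀ y, ((f y + c : ℝ) : EReal) ≤ h y) ∧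
      ((f x + c : ℝ) : EReal) = h x := by
  have hconv := EConv.convexOn hb hc
  set C := {x | h x ≠ ⊤} with hC
  set g : E → ℝ := fun x => (h x).toReal with hg
  have hcont : ContinuousOn g (interior C) := hconv.continuousOn_interior
  have hconv' : ConvexOn ℝ (interior C) g := hconv.subset interior_subset hconv.1.interior
  have hopen : IsOpen {p : E × ℝ | p.1 ∈ interior C ∧ g p.1 < p.2} := by
    have h1 : ContinuousOn (fun p : E × ℝ => p.2 - g p.1) (interior C ×ˢ univ) := by
      apply ContinuousOn.sub continuousOn_snd
      exact hcont.comp continuousOn_fst (fun p hp => hp.1)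
    have := h1.isOpen_inter_preimage (isOpen_interior.prod isOpen_univ) (isOpen_Ioi (a := (0:ℝ)))
    convert this using 1
    ext p
    simp
  obtain ⟨L, hL⟩ := geometric_hahn_banach_point_open (x := (x, g x)) hconv'.convex_strict_epigraph
    hopen (by simp)
  have hdec : ∀ y s, L (y, s) = L (y, 0) + s * L (0, 1) := by
    intro y s
    have : (y, s) = (y, (0:ℝ)) + s • ((0:E), (1:ℝ)) := by simp
    rw [this, map_add, map_smul, smul_eq_mul]
  set β := L (0, 1) with hβ
  have hβpos : 0 < β := by
    have := hL (x, g x + 1) ⟨hx, by simp⟩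
    rw [hdec x (g x), hdec x (g x + 1)] at this
    linarith
  have hint : ∀ y ∈ interior C, L (x, 0) + g x * β ≤ L (y, 0) + g y * β := by
    intro y hy
    refine le_of_forall_pos_le_add fun ε hε => ?_
    have := hL (y, g y + ε / β) ⟨hy, by simp; positivity⟩
    rw [hdec x (g x), hdec y (g y + ε / β)] at this
    have e : ε / β * β = ε := by field_simp
    nlinarith
  have hall : ∀ y ∈ C, L (x, 0) + g x * β ≤ L (y, 0) + g y * β := by
    intro y hy
    have ht : Tendsto (fun t : ℝ => (1 - t) • x + t • y) (𝓝[>] 0) (𝓝 x) := by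
      have : Continuous (fun t : ℝ => (1 - t) • x + t • y) := by fun_prop
      have h2 := this.tendsto 0
      simp only [sub_zero, one_smul, zero_smul, add_zero] at h2
      exact h2.mono_left nhdsWithin_le_nhds
    have h3 := ht.eventually (isOpen_interior.mem_nhds hx)
    have h4 : ∀ᶠ t : ℝ in 𝓝[>] 0, t < 1 :=
      nhdsWithin_le_nhds (gt_mem_nhds one_pos)
    obtain ⟨t, ht1, ht2, ht3⟩ := (h3.and (h4.and self_mem_nhdsWithin)).exists
    replace ht3 : 0 < t := ht3
    have h5 := hint _ ht1
    have h6 := hconv.2 (interior_subset hx) hy (by linarith : (0:ℝ) ≤ 1 - t) ht3.le (by ring)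
    have h7 : L ((1 - t) • x + t • y, 0) = (1 - t) * L (x, 0) + t * L (y, 0) := by
      have : ((1 - t) • x + t • y, (0:ℝ)) = (1 - t) • (x, (0:ℝ)) + t • (y, (0:ℝ)) := by simp
      rw [this, map_add, map_smul, map_smul]; simp
    rw [h7] at h5
    simp only [smul_eq_mul] at h6
    have h8 := mul_le_mul_of_nonneg_right h6 hβpos.le
    have : t * (L (x, 0) + g x * β) ≤ t * (L (y, 0) + g y * β) := by nlinarith
    exact le_of_mul_le_mul_left this ht3
  refine ⟨-(β⁻¹ • L.comp (ContinuousLinearMap.inl ℝ E ℝ)), β⁻¹ * L (x, 0) + g x, ?_, ?_⟩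
  · intro y
    by_cases hy : h y = ⊤
    · rw [hy]; exact le_top
    rw [← EReal.coe_toReal hy (hb y), EReal.coe_le_coe_iff]
    have := hall y hy
    simp only [neg_apply, smul_apply,
      ContinuousLinearMap.comp_apply, ContinuousLinearMap.inl_apply, smul_eq_mul]
    have h8 := mul_le_mul_of_nonneg_left this (inv_pos.2 hβpos).le
    have e : ∀ r : ℝ, β⁻¹ * (r * β) = r := fun r => by field_simp
    rw [mul_add, mul_add, e, e] at h8
    simp only [hg] at h8 ⊢
    linarith
  · have := EReal.coe_toReal (interior_subset hx) (hb x)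
    conv_rhs => rw [← this]
    congr 1
    simp [hg]

/-- Every proper convex function has an affine minorant. -/
lemma EConv.exists_minorant {E : Type*} [NormedAddCommGroup E] [InnerProductSpace ℝ E]
    [FiniteDimensional ℝ E] {h : E → EReal}
    (hb : ∀ x, h x ≠ ⊥) (hc : EConv h) :
    ∃ (f : E →L[ℝ] ℝ) (c : ℝ), (∀ y, ((f y + c : ℝ) : EReal) ≤ h y) := by
  by_cases hne : ∃ x, h x ≠ ⊤
  swap
  · push Not at hne
    exact ⟨0, 0, fun y => by rw [hne y]; exact le_top⟩
  obtain ⟨x0, hx0⟩ := hne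
  let V : Submodule ℝ E := Submodule.span ℝ ((fun x => x - x0) '' {x | h x ≠ ⊤})
  let π : E →L[ℝ] E := V.starProjection
  let k : E → EReal := fun x => h (x0 + π (x - x0))
  have hkb : ∀ x, k x ≠ ⊥ := fun x => hb _
  have hkc : EConv k := by
    intro x y a b ha hb' hab
    have := hc (x0 + π (x - x0)) (x0 + π (y - x0)) a b ha hb' hab
    convert this using 2
    have e : a • x + b • y - x0 = a • (x - x0) + b • (y - x0) := by
      obtain rfl : b = 1 - a := by linarith
      module
    rw [e, map_add, map_smul, map_smul]
    obtain rfl : b = 1 - a := by linarith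
    module
  have hmem : ∀ x, h x ≠ ⊤ → x - x0 ∈ V := fun x hx => Submodule.subset_span ⟨x, hx, rfl⟩
  have hfix : ∀ x, h x ≠ ⊤ → k x = h x := by
    intro x hx
    have : π (x - x0) = x - x0 := Submodule.starProjection_eq_self_iff.2 (hmem x hx)
    show h (x0 + π (x - x0)) = h x
    rw [this, add_sub_cancel]
  have hdom : (interior {x | k x ≠ ⊤}).Nonempty := by
    have hcv := (EConv.convexOn hkb hkc).1
    rw [hcv.interior_nonempty_iff_affineSpan_eq_top]
    have hx0k : x0 ∈ {x | k x ≠ ⊤} := by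
      show k x0 ≠ ⊤
      rw [hfix x0 hx0]; exact hx0
    rw [AffineSubspace.affineSpan_eq_top_iff_vectorSpan_eq_top_of_nonempty ℝ E E ⟨x0, hx0k⟩]
    rw [eq_top_iff, ← Submodule.sup_orthogonal_of_hasOrthogonalProjection (K := V)]
    refine sup_le ?_ ?_
    · refine Submodule.span_le.2 ?_
      rintro _ ⟨x, hx, rfl⟩
      refine vsub_mem_vectorSpan ℝ ?_ hx0k
      show k x ≠ ⊤
      rw [hfix x hx]; exact hx
    · intro v hv
      have : v = (x0 + v) -ᵥ x0 := by simp
      rw [this]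
      refine vsub_mem_vectorSpan ℝ ?_ hx0k
      show k (x0 + v) ≠ ⊤
      have : π v = 0 := (Submodule.starProjection_apply_eq_zero_iff V).2 hv
      simpa [k, this] using hx0
  obtain ⟨x, hx⟩ := hdom
  obtain ⟨f, c, hf, -⟩ := EConv.exists_support hkb hkc hx
  refine ⟨f, c, fun y => ?_⟩
  by_cases hy : h y = ⊤
  · rw [hy]; exact le_top
  · rw [← hfix y hy]; exact hf y

/-- A convex function is a.e. the supremum of a sequence of affine minorants. -/
lemma EConv.exists_seq {E : Type*} [NormedAddCommGroup E] [InnerProductSpace ℝ E]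
    [FiniteDimensional ℝ E] [MeasurableSpace E] [BorelSpace E] (μ : Measure E)
    [μ.IsAddHaarMeasure] {h : E → EReal}
    (hb : ∀ x, h x ≠ ⊥) (hc : EConv h) :
    ∃ (f : ℕ → E →L[ℝ] ℝ) (c : ℕ → ℝ), (∀ n y, ((f n y + c n : ℝ) : EReal) ≤ h y) ∧
      ∀ᵐ x ∂μ, (⨆ n, ((f n x + c n : ℝ) : EReal)) = h x := by
  obtain ⟨f0, c0, h0⟩ := EConv.exists_minorant hb hc
  let S : Set ((E →L[ℝ] ℝ) × ℝ) := {p | ∀ y, ((p.1 y + p.2 : ℝ) : EReal) ≤ h y}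
  have hS : (f0, c0) ∈ S := h0
  have : Nonempty S := ⟨⟨_, hS⟩⟩
  let q : ℕ → S := TopologicalSpace.denseSeq S
  have hcv := (EConv.convexOn hb hc).1
  refine ⟨fun n => (q n).1.1, fun n => (q n).1.2, fun n y => (q n).2 y, ?_⟩
  have hfr := hcv.addHaar_frontier (μ := μ)
  have : ∀ᵐ x ∂μ, x ∉ frontier {x | h x ≠ ⊤} := measure_eq_zero_iff_ae_notMem.1 hfr
  filter_upwards [this] with x hx
  apply le_antisymm (iSup_le fun n => (q n).2 x)
  have hdense : ∀ p ∈ S, ((p.1 x + p.2 : ℝ) : EReal) ≤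
      ⨆ n, (((q n).1.1 x + (q n).1.2 : ℝ) : EReal) := by
    intro p hp
    have hcl : IsClosed {p : S | ((p.1.1 x + p.1.2 : ℝ) : EReal) ≤
        ⨆ n, (((q n).1.1 x + (q n).1.2 : ℝ) : EReal)} := by
      refine isClosed_le ?_ continuous_const
      refine continuous_coe_real_ereal.comp ?_
      have : Continuous fun p : S => (p.1.1 : E →L[ℝ] ℝ) := by fun_prop
      exact (this.clm_apply continuous_const).add (by fun_prop)
    have := (TopologicalSpace.denseRange_denseSeq S).induction_on (p := fun p : S =>
      ((p.1.1 x + p.1.2 : ℝ) : EReal) ≤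
        ⨆ n, (((q n).1.1 x + (q n).1.2 : ℝ) : EReal)) ⟨p, hp⟩ hcl
        (fun n => le_iSup (fun n => (((q n).1.1 x + (q n).1.2 : ℝ) : EReal)) n)
    exact this
  by_cases hxi : x ∈ interior {x | h x ≠ ⊤}
  · obtain ⟨f, c, hf, hfx⟩ := EConv.exists_support hb hc hxi
    rw [← hfx]
    exact hdense (f, c) hf
  · have hxc : x ∉ closure {x | h x ≠ ⊤} := by
      intro hcl
      exact hx ⟨hcl, hxi⟩
    obtain ⟨f, u, hfx, hfu⟩ := geometric_hahn_banach_point_closed hcv.closure isClosed_closure hxc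
    have hmem : ∀ n : ℕ, (f0 - (n : ℝ) • f, c0 + n * u) ∈ S := by
      intro n y
      by_cases hy : h y = ⊤
      · rw [hy]; exact le_top
      refine le_trans ?_ (h0 y)
      rw [EReal.coe_le_coe_iff]
      have := hfu y (subset_closure hy)
      have h2 := mul_le_mul_of_nonneg_left this.le (Nat.cast_nonneg (α := ℝ) n)
      simp
      linarith
    have htop : (⨆ n, (((q n).1.1 x + (q n).1.2 : ℝ) : EReal)) = ⊤ := by
      rw [EReal.eq_top_iff_forall_lt]
      intro r
      obtain ⟨n, hn⟩ := exists_nat_gt ((r - (f0 x + c0)) / (u - f x))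
      refine lt_of_lt_of_le ?_ (hdense _ (hmem n))
      rw [EReal.coe_lt_coe_iff]
      rw [div_lt_iff₀ (by linarith)] at hn
      simp
      linarith
    rw [htop]; exact le_top

lemma toENN_eq_s4 : EReal.toENN = EReal.toENNReal := rfl

lemma eint_mono {E : Type*} [MeasurableSpace E] (Q : Measure E) {φ χ : E → EReal}
    (h : ∀ x, φ x ≤ χ x) : eint Q φ ≤ eint Q χ := by
  unfold eint
  rw [toENN_eq_s4]
  refine EReal.sub_le_sub ?_ ?_
  · exact EReal.coe_ennreal_le_coe_ennreal_iff.2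
      (lintegral_mono fun x => EReal.toENNReal_le_toENNReal (h x))
  · exact EReal.coe_ennreal_le_coe_ennreal_iff.2
      (lintegral_mono fun x => EReal.toENNReal_le_toENNReal (EReal.neg_le_neg_iff.2 (h x)))

lemma eint_congr {E : Type*} [MeasurableSpace E] {Q : Measure E} {φ χ : E → EReal}
    (h : φ =ᵐ[Q] χ) : eint Q φ = eint Q χ := by
  unfold eint
  have h1 : ∫⁻ x, (φ x).toENN ∂Q = ∫⁻ x, (χ x).toENN ∂Q :=
    lintegral_congr_ae (h.fun_comp EReal.toENN)
  have h2 : ∫⁻ x, (-(φ x)).toENN ∂Q = ∫⁻ x, (-(χ x)).toENN ∂Q :=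
    lintegral_congr_ae (h.fun_comp fun y => (-y).toENN)
  rw [h1, h2]

lemma eint_coe {E : Type*} [MeasurableSpace E] {Q : Measure E} {v : E → ℝ}
    (hv : Integrable v Q) : eint Q (fun x => (v x : EReal)) = ((∫ x, v x ∂Q : ℝ) : EReal) := by
  unfold eint
  rw [integral_eq_lintegral_pos_part_sub_lintegral_neg_part hv, toENN_eq_s4]
  have h1 : ∫⁻ x, (v x : EReal).toENNReal ∂Q = ∫⁻ x, ENNReal.ofReal (v x) ∂Q := rfl
  have h2 : ∫⁻ x, (-(v x : EReal)).toENNReal ∂Q = ∫⁻ x, ENNReal.ofReal (-(v x)) ∂Q := rfl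
  have h3 : ∫⁻ x, ENNReal.ofReal (v x) ∂Q ≠ ⊤ := hv.lintegral_lt_top.ne
  have h4 : ∫⁻ x, ENNReal.ofReal (-(v x)) ∂Q ≠ ⊤ := hv.neg.lintegral_lt_top.ne
  rw [h1, h2, EReal.coe_sub]
  congr 1
  · exact (EReal.coe_ennreal_toReal h3).symm
  · congr 1
    exact (EReal.coe_ennreal_toReal h4).symm

lemma one_add_le_exp {c s : ℝ} (hc : 0 < c) (hs : 0 ≤ s) :
    1 + s ≤ (1 + 1 / c) * Real.exp (c * s) := by
  have h1 : 1 ≤ Real.exp (c * s) := Real.one_le_exp (by positivity)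
  have h2 : c * s ≤ Real.exp (c * s) := by linarith [Real.add_one_le_exp (c * s)]
  have h3 : s ≤ 1 / c * Real.exp (c * s) := by
    rw [one_div, ← div_eq_inv_mul, le_div_iff₀ hc]; linarith
  linarith

lemma exp_le_quad (s : ℝ) : Real.exp (-s) ≤ 1 - s + s ^ 2 * Real.exp |s| := by
  have := Complex.norm_exp_sub_sum_le_norm_mul_exp ((-s : ℝ) : ℂ) 2
  simp only [Finset.sum_range_succ, Finset.sum_range_zero] at this
  have e : Complex.exp ((-s : ℝ) : ℂ) - (0 + ((-s : ℝ) : ℂ) ^ 0 / ((0).factorial : ℂ) +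
      ((-s : ℝ) : ℂ) ^ 1 / ((1).factorial : ℂ)) = ((Real.exp (-s) - (1 - s) : ℝ) : ℂ) := by
    push_cast
    simp
    ring
  rw [e, Complex.norm_real, Complex.norm_real, Real.norm_eq_abs, Real.norm_eq_abs, abs_neg,
    sq_abs] at this
  linarith [le_abs_self (Real.exp (-s) - (1 - s))]

section
variable {E : Type*} [NormedAddCommGroup E] [InnerProductSpace ℝ E] [FiniteDimensional ℝ E]

lemma IsPhi.exists_bound_s4 {ψ : E → EReal} (h : IsPhi ψ) :
    ∃ A b : ℝ, 0 < b ∧ ∀ x, ψ x ≤ ((A - b * ‖x‖ : ℝ) : EReal) := by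
  obtain ⟨husc, htop, hconc, hco⟩ := h
  by_cases hne : ∃ x0, ψ x0 ≠ ⊥
  swap
  · push Not at hne
    exact ⟨0, 1, one_pos, fun x => by rw [hne x]; exact bot_le⟩
  obtain ⟨x0, hx0⟩ := hne
  set r := (ψ x0).toReal with hr
  have hr' : ψ x0 = (r : EReal) := (EReal.coe_toReal (htop x0) hx0).symm
  have h1 := (EReal.tendsto_nhds_bot_iff_real.1 hco) (r - 1)
  rw [Filter.eventually_comap] at h1
  obtain ⟨R0, hR0⟩ := Filter.eventually_atTop.1 h1
  have hR0' : ∀ x : E, R0 ≤ ‖x‖ → ψ x < ((r - 1 : ℝ) : EReal) := fun x hx => hR0 _ hx x rfl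
  set R := |R0| + ‖x0‖ + 1 with hR
  have hRpos : 0 < R := by positivity
  obtain ⟨xm, -, hxm⟩ := UpperSemicontinuousOn.exists_isMaxOn (s := Metric.closedBall x0 R)
    ⟨x0, Metric.mem_closedBall_self hRpos.le⟩ (isCompact_closedBall x0 R)
    (husc.upperSemicontinuousOn _)
  obtain ⟨M, hM⟩ : ∃ M : ℝ, ∀ x ∈ Metric.closedBall x0 R, ψ x ≤ (M : EReal) := by
    refine ⟨(ψ xm).toReal, fun x hx => (hxm hx).trans (EReal.le_coe_toReal (htop xm))⟩
  have hout : ∀ x, x ∉ Metric.closedBall x0 R → ψ x ≤ ((r - ‖x - x0‖ / R : ℝ) : EReal) := by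
    intro x hx
    rw [Metric.mem_closedBall, dist_eq_norm, not_le] at hx
    by_cases hxb : ψ x = ⊥
    · rw [hxb]; exact bot_le
    set p := (ψ x).toReal with hp
    have hp' : ψ x = (p : EReal) := (EReal.coe_toReal (htop x) hxb).symm
    have hn : 0 < ‖x - x0‖ := hRpos.trans hx
    set s := R / ‖x - x0‖ with hs
    have hs0 : 0 < s := by positivity
    have hs1 : s < 1 := (div_lt_one hn).2 hx
    have h3 := hconc x0 x (1 - s) s (by linarith) hs0 (by ring)
    have e : (1 - s) • x0 + s • x = x0 + s • (x - x0) := by module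
    have hz : R0 ≤ ‖x0 + s • (x - x0)‖ := by
      have h4 : ‖s • (x - x0)‖ = R := by
        rw [norm_smul, Real.norm_of_nonneg hs0.le, hs]; field_simp
      have h5 := norm_sub_norm_le (s • (x - x0)) (-x0)
      rw [sub_neg_eq_add, norm_neg, h4, add_comm _ x0] at h5
      linarith [le_abs_self R0]
    have h6 := h3.trans ((e ▸ hR0' _ hz).le)
    rw [hr', hp'] at h6
    have h7 : (1 - s) * r + s * p ≤ r - 1 := by exact_mod_cast h6
    rw [hp', EReal.coe_le_coe_iff]
    have h8 : ‖x - x0‖ / R = 1 / s := by rw [hs]; field_simp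
    rw [h8]
    have h9 : s * p ≤ s * (r - 1 / s) := by
      have : s * (1 / s) = 1 := by field_simp
      nlinarith
    exact le_of_mul_le_mul_left h9 hs0
  refine ⟨max (M + (R + ‖x0‖) / R) (r + ‖x0‖ / R), 1 / R, by positivity, fun x => ?_⟩
  by_cases hx : x ∈ Metric.closedBall x0 R
  · refine (hM x hx).trans ?_
    rw [EReal.coe_le_coe_iff]
    rw [Metric.mem_closedBall, dist_eq_norm] at hx
    have h2 : ‖x‖ ≤ R + ‖x0‖ := by
      have := norm_sub_norm_le x x0
      linarith
    have h3 : 1 / R * ‖x‖ ≤ (R + ‖x0‖) / R := by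
      rw [one_div, ← div_eq_inv_mul]; gcongr
    linarith [le_max_left (M + (R + ‖x0‖) / R) (r + ‖x0‖ / R)]
  · refine (hout x hx).trans ?_
    rw [EReal.coe_le_coe_iff]
    have h2 := norm_sub_norm_le x x0
    have h3 : (‖x‖ - ‖x0‖) / R ≤ ‖x - x0‖ / R := by gcongr
    have h4 : 1 / R * ‖x‖ = ‖x‖ / R := by ring
    rw [sub_div] at h3
    linarith [le_max_right (M + (R + ‖x0‖) / R) (r + ‖x0‖ / R)]

variable [MeasureSpace E] [BorelSpace E] [(volume : Measure E).IsAddHaarMeasure]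

lemma integrable_exp_norm {c : ℝ} (hc : 0 < c) :
    Integrable (fun x : E => Real.exp (-(c * ‖x‖))) := by
  set n : ℕ := Module.finrank ℝ E + 1 with hn
  have hnpos : (0:ℝ) < n := by positivity
  have h1 : Integrable (fun x : E => (1 + ‖x‖) ^ (-(n : ℝ))) :=
    integrable_one_add_norm (by rw [hn]; push_cast; linarith)
  refine (h1.const_mul ((1 + 1 / (c / n)) ^ n)).mono' (by fun_prop) (ae_of_all _ fun x => ?_)
  rw [Real.norm_of_nonneg (Real.exp_pos _).le, Real.rpow_neg (by positivity), Real.rpow_natCast,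
    ← div_eq_mul_inv, le_div_iff₀ (by positivity)]
  have h2 := one_add_le_exp (c := c / n) (by positivity) (norm_nonneg x)
  have h3 := pow_le_pow_left₀ (by positivity) h2 n
  rw [mul_pow, ← Real.exp_nat_mul] at h3
  have e : (n : ℝ) * (c / n * ‖x‖) = c * ‖x‖ := by field_simp
  rw [e] at h3
  calc Real.exp (-(c * ‖x‖)) * (1 + ‖x‖) ^ n ≤ Real.exp (-(c * ‖x‖)) *
        ((1 + 1 / (c / n)) ^ n * Real.exp (c * ‖x‖)) := by gcongr
    _ = (1 + 1 / (c / n)) ^ n * (Real.exp (-(c * ‖x‖)) * Real.exp (c * ‖x‖)) := by ring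
    _ = _ := by rw [← Real.exp_add]; simp

lemma expw_le {φ : E → EReal} {A b : ℝ} (hφ : ∀ x, φ x ≤ ((A - b * ‖x‖ : ℝ) : EReal)) (x : E) :
    (EReal.exp (φ x)).toReal ≤ Real.exp A * Real.exp (-(b * ‖x‖)) := by
  have h1 := EReal.exp_monotone (hφ x)
  rw [EReal.exp_coe] at h1
  have := ENNReal.toReal_mono ENNReal.ofReal_ne_top h1
  rw [ENNReal.toReal_ofReal (Real.exp_pos _).le] at this
  rwa [← Real.exp_add, ← sub_eq_add_neg]

lemma measurable_expw {φ : E → EReal} (hm : Measurable φ) :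
    Measurable fun x => (EReal.exp (φ x)).toReal := by
  have : Measurable fun x => EReal.exp (φ x) := by fun_prop
  exact this.ennreal_toReal

/-- `w * F` is integrable for `F` of moderate exponential growth. -/
lemma integrable_expw_mul {φ : E → EReal} {A b : ℝ} (hb : 0 < b)
    (hφ : ∀ x, φ x ≤ ((A - b * ‖x‖ : ℝ) : EReal)) (hm : Measurable φ) {F : E → ℝ} {C : ℝ}
    (hF : Measurable F) (hFb : ∀ x, |F x| ≤ C * Real.exp (b / 2 * ‖x‖)) :
    Integrable (fun x => (EReal.exp (φ x)).toReal * F x) := by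
  refine ((integrable_exp_norm (E := E) (half_pos hb)).const_mul (Real.exp A * C)).mono'
    ((measurable_expw hm).mul hF).aestronglyMeasurable (ae_of_all _ fun x => ?_)
  rw [norm_mul, Real.norm_of_nonneg ENNReal.toReal_nonneg, Real.norm_eq_abs]
  calc _ ≤ (Real.exp A * Real.exp (-(b * ‖x‖))) * (C * Real.exp (b / 2 * ‖x‖)) :=
        mul_le_mul (expw_le hφ x) (hFb x) (abs_nonneg _) (by positivity)
    _ = Real.exp A * C * (Real.exp (-(b * ‖x‖)) * Real.exp (b / 2 * ‖x‖)) := by ring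
    _ = _ := by rw [← Real.exp_add]; congr 2; ring

lemma integrable_expw {φ : E → EReal} {A b : ℝ} (hb : 0 < b)
    (hφ : ∀ x, φ x ≤ ((A - b * ‖x‖ : ℝ) : EReal)) (hm : Measurable φ) :
    Integrable (fun x => (EReal.exp (φ x)).toReal) := by
  have := integrable_expw_mul hb hφ hm (F := fun _ => 1) (C := 1) measurable_const
    (fun x => by simp; positivity)
  simpa using this

lemma Lfun_eq_s4 {Q : Measure E} {φ : E → EReal} {v : E → ℝ} (hv : Integrable v Q)
    (hφv : φ =ᵐ[Q] fun x => (v x : EReal)) {A b : ℝ} (hb : 0 < b)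
    (hφ : ∀ x, φ x ≤ ((A - b * ‖x‖ : ℝ) : EReal)) (hm : Measurable φ) :
    Lfun φ Q = (((∫ x, v x ∂Q) - (∫ x, (EReal.exp (φ x)).toReal) + 1 : ℝ) : EReal) := by
  have hI := integrable_expw hb hφ hm
  unfold Lfun
  rw [eint_congr hφv, eint_coe hv]
  have h1 : ∫⁻ x, EReal.exp (φ x) = ENNReal.ofReal (∫ x, (EReal.exp (φ x)).toReal) := by
    rw [ofReal_integral_eq_lintegral_ofReal hI (ae_of_all _ fun x => ENNReal.toReal_nonneg)]
    refine lintegral_congr fun x => ?_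
    rw [ENNReal.ofReal_toReal]
    rw [Ne, EReal.exp_eq_top_iff]
    exact ne_top_of_le_ne_top (EReal.coe_ne_top _) (hφ x)
  have h2 : 0 ≤ ∫ x, (EReal.exp (φ x)).toReal := integral_nonneg fun x => ENNReal.toReal_nonneg
  rw [h1, EReal.coe_ennreal_ofReal, max_eq_left h2]
  push_cast
  rfl

end

lemma coercive_of_bound {E : Type*} [NormedAddCommGroup E] {φ : E → EReal} {A b : ℝ}
    (hb : 0 < b) (hφ : ∀ x, φ x ≤ ((A - b * ‖x‖ : ℝ) : EReal)) :
    Tendsto φ (Filter.comap (fun x : E => ‖x‖) atTop) (𝓝 ⊥) := by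
  rw [EReal.tendsto_nhds_bot_iff_real]
  intro r
  rw [Filter.eventually_comap]
  filter_upwards [Filter.eventually_gt_atTop ((A - r) / b)] with s hs x hx
  refine (hφ x).trans_lt ?_
  rw [EReal.coe_lt_coe_iff, hx]
  rw [div_lt_iff₀ hb] at hs
  linarith

section
variable {E : Type*} [NormedAddCommGroup E] [InnerProductSpace ℝ E] [FiniteDimensional ℝ E]

/-- Perturbation of an element of `Φ` by a real convex function. -/
lemma IsPhi.perturb {ψ : E → EReal} (h : IsPhi ψ) {g : E → ℝ} (hgc : Continuous g)
    (hg : ConvexOn ℝ univ g) {A b : ℝ} (hb : 0 < b)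
    (hφ : ∀ x, ψ x + ((-(g x) : ℝ) : EReal) ≤ ((A - b * ‖x‖ : ℝ) : EReal)) :
    IsPhi (fun x => ψ x + ((-(g x) : ℝ) : EReal)) := by
  obtain ⟨husc, htop, hconc, hco⟩ := h
  refine ⟨?_, ?_, ?_, coercive_of_bound hb hφ⟩
  · refine husc.add' (g := fun x => ((-(g x) : ℝ) : EReal)) ?_ ?_
    · exact (continuous_coe_real_ereal.comp hgc.neg).upperSemicontinuous
    · intro x
      exact EReal.continuousAt_add (Or.inl (htop x)) (Or.inr (EReal.coe_ne_top _))
  · intro x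
    exact ne_top_of_le_ne_top (EReal.coe_ne_top _) (hφ x)
  · intro x y a c ha hc hac
    have h1 := hconc x y a c ha hc hac
    have h2 := hg.2 (mem_univ x) (mem_univ y) ha.le hc.le hac
    beta_reduce
    by_cases hx : ψ x = ⊥
    · rw [hx, EReal.bot_add, EReal.coe_mul_bot_of_pos ha, EReal.bot_add]; exact bot_le
    by_cases hy : ψ y = ⊥
    · rw [hy, EReal.bot_add, EReal.coe_mul_bot_of_pos hc, EReal.add_bot]; exact bot_le
    rw [← EReal.coe_toReal (htop x) hx, ← EReal.coe_toReal (htop y) hy] at h1 ⊢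
    have h3 : ψ (a • x + c • y) ≠ ⊥ := by
      intro h0
      rw [h0, le_bot_iff] at h1
      exact EReal.coe_ne_bot (a * (ψ x).toReal + c * (ψ y).toReal) (by exact_mod_cast h1)
    rw [← EReal.coe_toReal (htop _) h3] at h1 ⊢
    have h4 : a * (ψ x).toReal + c * (ψ y).toReal ≤ (ψ (a • x + c • y)).toReal := by
      exact_mod_cast h1
    have h5 : a * ((ψ x).toReal + -(g x)) + c * ((ψ y).toReal + -(g y)) ≤
        (ψ (a • x + c • y)).toReal + -(g (a • x + c • y)) := by
      simp only [smul_eq_mul] at h2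
      linarith
    exact_mod_cast h5

variable [MeasureSpace E] [BorelSpace E] [(volume : Measure E).IsAddHaarMeasure]

lemma IsMLE.facts {Q : Measure E} [IsProbabilityMeasure Q] (hmom : Integrable (fun x : E => ‖x‖) Q)
    {ψ : E → EReal} (hψ : IsMLE Q ψ) :
    (ψ =ᵐ[Q] fun x => ((ψ x).toReal : EReal)) ∧ Integrable (fun x => (ψ x).toReal) Q := by
  obtain ⟨hphi, hmax⟩ := hψ
  have hm : Measurable ψ := hphi.1.measurable
  obtain ⟨A, b, hb, hA⟩ := hphi.exists_bound_s4
  have hphi0 : IsPhi (fun x : E => ((-‖x‖ : ℝ) : EReal)) := by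
    refine ⟨?_, fun x => EReal.coe_ne_top _, ?_, ?_⟩
    · exact (continuous_coe_real_ereal.comp continuous_norm.neg).upperSemicontinuous
    · intro x y a c ha hc hac
      have h2 := (convexOn_univ_norm (E := E)).2 (mem_univ x) (mem_univ y) ha.le hc.le hac
      simp only [smul_eq_mul] at h2
      beta_reduce
      have h5 : a * (-‖x‖) + c * (-‖y‖) ≤ -‖a • x + c • y‖ := by linarith
      exact_mod_cast h5
    · exact coercive_of_bound (A := 0) (b := 1) one_pos (fun x => by simp)
  have hle := hmax _ hphi0
  rw [Lfun_eq_s4 (v := fun x => -‖x‖) hmom.neg (ae_of_all _ fun x => rfl) (A := 0) (b := 1) one_pos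
    (fun x => by simp) hphi0.1.measurable] at hle
  have hneg : ∫⁻ x, (-(ψ x)).toENNReal ∂Q ≠ ⊤ := by
    intro htop
    have : Lfun ψ Q = ⊥ := by
      unfold Lfun eint
      rw [toENN_eq_s4, htop, EReal.coe_ennreal_top, EReal.sub_top, EReal.bot_sub, EReal.bot_add]
    rw [this, le_bot_iff] at hle
    exact EReal.coe_ne_bot _ hle
  have hpos : ∫⁻ x, (ψ x).toENNReal ∂Q ≠ ⊤ := by
    have h1 : ∫⁻ x, (ψ x).toENNReal ∂Q ≤ ∫⁻ x, ENNReal.ofReal A ∂Q := by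
      refine lintegral_mono fun x => ?_
      refine (EReal.toENNReal_le_toENNReal (hA x)).trans ?_
      rw [EReal.real_coe_toENNReal]
      refine ENNReal.ofReal_le_ofReal ?_
      have : 0 ≤ b * ‖x‖ := by positivity
      linarith
    refine ne_top_of_le_ne_top ?_ h1
    simp
  have hmneg : Measurable fun x => (-(ψ x)).toENNReal := hm.neg.ereal_toENNReal
  constructor
  · filter_upwards [ae_lt_top hmneg hneg] with x hx
    refine (EReal.coe_toReal (hphi.2.1 x) ?_).symm
    intro h0
    rw [h0] at hx
    simp at hx
  · refine ⟨hm.ereal_toReal.aestronglyMeasurable, ?_⟩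
    have h1 : ∫⁻ x, ‖(ψ x).toReal‖ₑ ∂Q ≤
        ∫⁻ x, ((ψ x).toENNReal + (-(ψ x)).toENNReal) ∂Q := by
      refine lintegral_mono fun x => ?_
      by_cases hx : ψ x = ⊥
      · simp [hx]
      rw [← EReal.coe_toReal (hphi.2.1 x) hx]
      generalize (ψ x).toReal = r
      rw [← EReal.coe_neg, EReal.real_coe_toENNReal, EReal.real_coe_toENNReal, EReal.toReal_coe,
        Real.enorm_eq_ofReal_abs]
      rcases le_total 0 r with hr | hr
      · rw [abs_of_nonneg hr]; exact le_self_add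
      · rw [abs_of_nonpos hr]; exact le_add_self
    refine lt_of_le_of_lt h1 ?_
    rw [lintegral_add_right _ hmneg]
    exact ENNReal.add_lt_top.2 ⟨hpos.lt_top, hneg.lt_top⟩

lemma IsMLE.key {Q : Measure E} [IsProbabilityMeasure Q] (hmom : Integrable (fun x : E => ‖x‖) Q)
    {ψ : E → EReal} (hψ : IsMLE Q ψ) {g : E → ℝ} (hgc : Continuous g)
    (hg : ConvexOn ℝ univ g) {K : ℝ} (hK : 0 < K) (hgK : ∀ x, |g x| ≤ K * (1 + ‖x‖)) :
    Integrable (fun x => (EReal.exp (ψ x)).toReal * g x) ∧ Integrable g Q ∧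
    ∫ x, (EReal.exp (ψ x)).toReal * g x ≤ ∫ x, g x ∂Q := by
  obtain ⟨hae, hu⟩ := hψ.facts hmom
  obtain ⟨hphi, hmax⟩ := hψ
  have hm : Measurable ψ := hphi.1.measurable
  obtain ⟨A, b, hb, hA⟩ := hphi.exists_bound_s4
  have hgQ : Integrable g Q := by
    refine (((integrable_const (1:ℝ)).add hmom).const_mul K).mono' hgc.aestronglyMeasurable
      (ae_of_all _ fun x => ?_)
    exact hgK x
  set t0 := b / (4 * K) with ht0
  have ht0pos : 0 < t0 := by positivity
  have ht0K : t0 * K = b / 4 := by rw [ht0]; field_simp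
  set C := 1 + 1 / (b / 8) with hC
  have hCpos : 0 < C := by positivity
  have hlin : ∀ x : E, 1 + ‖x‖ ≤ C * Real.exp (b / 8 * ‖x‖) := fun x =>
    one_add_le_exp (by positivity) (norm_nonneg x)
  have hint1 : Integrable (fun x => (EReal.exp (ψ x)).toReal * g x) := by
    refine integrable_expw_mul hb hA hm hgc.measurable (C := K * C) fun x => ?_
    refine (hgK x).trans ?_
    rw [mul_assoc]
    refine mul_le_mul_of_nonneg_left ((hlin x).trans ?_) hK.le
    have : b / 8 * ‖x‖ ≤ b / 2 * ‖x‖ := by gcongr; norm_num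
    gcongr
  have hexpg : ∀ x, Real.exp (t0 * |g x|) ≤ Real.exp (b / 4) * Real.exp (b / 4 * ‖x‖) := by
    intro x
    rw [← Real.exp_add]
    apply Real.exp_le_exp.2
    calc t0 * |g x| ≤ t0 * (K * (1 + ‖x‖)) := by gcongr; exact hgK x
      _ = (t0 * K) * (1 + ‖x‖) := by ring
      _ = _ := by rw [ht0K]; ring
  have hint2 : Integrable (fun x => (EReal.exp (ψ x)).toReal *
      (g x ^ 2 * Real.exp (t0 * |g x|))) := by
    refine integrable_expw_mul hb hA hm (by fun_prop) (C := K ^ 2 * C ^ 2 * Real.exp (b / 4))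
      fun x => ?_
    rw [abs_of_nonneg (by positivity)]
    have h1 : g x ^ 2 ≤ (K * (C * Real.exp (b / 8 * ‖x‖))) ^ 2 := by
      rw [← sq_abs]
      refine pow_le_pow_left₀ (abs_nonneg _) ((hgK x).trans ?_) 2
      exact mul_le_mul_of_nonneg_left (hlin x) hK.le
    calc _ ≤ (K * (C * Real.exp (b / 8 * ‖x‖))) ^ 2 *
          (Real.exp (b / 4) * Real.exp (b / 4 * ‖x‖)) := by
            gcongr
            exact hexpg x
      _ = K ^ 2 * C ^ 2 * Real.exp (b / 4) * (Real.exp (b / 8 * ‖x‖) ^ 2 *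
          Real.exp (b / 4 * ‖x‖)) := by ring
      _ = _ := by
        rw [← Real.exp_nat_mul, ← Real.exp_add]
        congr 2
        push_cast
        ring
  refine ⟨hint1, hgQ, ?_⟩
  set M := ∫ x, (EReal.exp (ψ x)).toReal * (g x ^ 2 * Real.exp (t0 * |g x|)) with hM
  have hw := integrable_expw hb hA hm
  have hmain : ∀ t, 0 < t → t ≤ t0 →
      (∫ x, (EReal.exp (ψ x)).toReal * g x) - t * M ≤ ∫ x, g x ∂Q := by
    intro t ht htt
    have hbd : ∀ x, ψ x + ((-(t * g x) : ℝ) : EReal) ≤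
        (((A + b / 4) - (3 * b / 4) * ‖x‖ : ℝ) : EReal) := by
      intro x
      refine (add_le_add_left (hA x) _).trans ?_
      rw [← EReal.coe_add, EReal.coe_le_coe_iff]
      have h1 : -(t * g x) ≤ t0 * (K * (1 + ‖x‖)) := by
        calc -(t * g x) ≤ |t * g x| := neg_le_abs _
          _ = t * |g x| := by rw [abs_mul, abs_of_pos ht]
          _ ≤ t0 * (K * (1 + ‖x‖)) := by gcongr; exact hgK x
      rw [← mul_assoc, ht0K] at h1
      linarith
    have hphit := hphi.perturb (g := fun x => t * g x) (by fun_prop) (hg.smul ht.le)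
      (by positivity : 0 < 3 * b / 4) hbd
    have hle := hmax _ hphit
    rw [Lfun_eq_s4 hu hae hb hA hm, Lfun_eq_s4 (v := fun x => (ψ x).toReal - t * g x)
      (hu.sub (hgQ.const_mul t)) ?_ (by positivity : 0 < 3 * b / 4) hbd hphit.1.measurable,
      EReal.coe_le_coe_iff, integral_sub hu (hgQ.const_mul t), integral_const_mul] at hle
    swap
    · filter_upwards [hae] with x hx
      rw [hx, ← EReal.coe_add, EReal.toReal_coe]
      congr 1
    have hexp : ∀ x, (EReal.exp (ψ x + ((-(t * g x) : ℝ) : EReal))).toReal =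
        (EReal.exp (ψ x)).toReal * Real.exp (-(t * g x)) := by
      intro x
      rw [EReal.exp_add, ENNReal.toReal_mul, EReal.exp_coe,
        ENNReal.toReal_ofReal (Real.exp_pos _).le]
    have hI := integrable_expw (by positivity : 0 < 3 * b / 4) hbd hphit.1.measurable
    have hle2 : ∫ x, (EReal.exp (ψ x + ((-(t * g x) : ℝ) : EReal))).toReal ≤
        ∫ x, ((EReal.exp (ψ x)).toReal - t * ((EReal.exp (ψ x)).toReal * g x) +
          t ^ 2 * ((EReal.exp (ψ x)).toReal * (g x ^ 2 * Real.exp (t0 * |g x|)))) := by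
      refine integral_mono hI ((hw.sub (hint1.const_mul t)).add (hint2.const_mul (t ^ 2))) ?_
      intro x
      simp only
      rw [hexp]
      have h1 := exp_le_quad (t * g x)
      have h2 : Real.exp |t * g x| ≤ Real.exp (t0 * |g x|) := by
        rw [abs_mul, abs_of_pos ht]
        gcongr
      have h3 : Real.exp (-(t * g x)) ≤ 1 - t * g x + (t * g x) ^ 2 * Real.exp (t0 * |g x|) :=
        h1.trans (by gcongr)
      have h4 := mul_le_mul_of_nonneg_left h3
        (ENNReal.toReal_nonneg (a := EReal.exp (ψ x)))
      refine h4.trans (le_of_eq ?_)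
      ring
    have hsub : Integrable (fun x => (EReal.exp (ψ x)).toReal -
        t * ((EReal.exp (ψ x)).toReal * g x)) := hw.sub (hint1.const_mul t)
    rw [integral_add hsub (hint2.const_mul (t ^ 2)),
      integral_sub hw (hint1.const_mul t), integral_const_mul, integral_const_mul, ← hM] at hle2
    have h5 : t * ((∫ x, (EReal.exp (ψ x)).toReal * g x) - t * M) ≤ t * ∫ x, g x ∂Q := by
      nlinarith
    exact le_of_mul_le_mul_left h5 ht
  have hlim : Tendsto (fun t : ℝ => (∫ x, (EReal.exp (ψ x)).toReal * g x) - t * M) (𝓝[>] 0)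
      (𝓝 (∫ x, (EReal.exp (ψ x)).toReal * g x)) := by
    have : Continuous (fun t : ℝ => (∫ x, (EReal.exp (ψ x)).toReal * g x) - t * M) := by fun_prop
    have h2 := this.tendsto 0
    simp only [zero_mul, sub_zero] at h2
    exact h2.mono_left nhdsWithin_le_nhds
  refine le_of_tendsto hlim ?_
  filter_upwards [self_mem_nhdsWithin, nhdsWithin_le_nhds (Iic_mem_nhds ht0pos)] with t h1 h2
  exact hmain t h1 h2

/-- The key inequality in terms of the measure `P`. -/
lemma IsMLE.key' {Q : Measure E} [IsProbabilityMeasure Q] (hmom : Integrable (fun x : E => ‖x‖) Q)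
    {ψ : E → EReal} (hψ : IsMLE Q ψ) {g : E → ℝ} (hgc : Continuous g)
    (hg : ConvexOn ℝ univ g) {K : ℝ} (hK : 0 < K) (hgK : ∀ x, |g x| ≤ K * (1 + ‖x‖)) :
    Integrable g (volume.withDensity fun x => EReal.exp (ψ x)) ∧ Integrable g Q ∧
    ∫ x, g x ∂(volume.withDensity fun x => EReal.exp (ψ x)) ≤ ∫ x, g x ∂Q := by
  have hm : Measurable ψ := hψ.1.1.measurable
  have hme : Measurable fun x => EReal.exp (ψ x) := by fun_prop
  have hfin : ∀ᵐ x : E, EReal.exp (ψ x) < ⊤ := ae_of_all _ fun x =>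
    EReal.exp_lt_top_iff.2 (hψ.1.2.1 x).lt_top
  obtain ⟨h1, h2, h3⟩ := hψ.key hmom hgc hg hK hgK
  refine ⟨?_, h2, ?_⟩
  · rw [integrable_withDensity_iff hme hfin]
    simpa only [mul_comm] using h1
  · rw [integral_withDensity_eq_integral_toReal_smul hme hfin]
    simpa only [smul_eq_mul] using h3

end

theorem MLE_moment_inequalities {d : ℕ}
    (Q : Measure (EuclideanSpace ℝ (Fin d))) [IsProbabilityMeasure Q]
    (hmom : (∫⁻ x, (‖x‖₊ : ℝ≥0∞) ∂Q) ≠ ⊤) (hint : (interior (csupp Q)).Nonempty)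
    (ψ : EuclideanSpace ℝ (Fin d) → EReal) (hψ : IsMLE Q ψ) :
    (∀ h : EuclideanSpace ℝ (Fin d) → EReal, (∀ x, h x ≠ ⊥) →
      (∀ x y : EuclideanSpace ℝ (Fin d), ∀ a b : ℝ, 0 < a → 0 < b → a + b = 1 →
        h (a • x + b • y) ≤ (a : EReal) * h x + (b : EReal) * h y) →
      eint (volume.withDensity fun x => EReal.exp (ψ x)) h ≤ eint Q h) ∧
    (∫ x, x ∂(volume.withDensity fun x => EReal.exp (ψ x))) = ∫ x, x ∂Q := by
  have hid : Integrable (fun x : EuclideanSpace ℝ (Fin d) => x) Q :=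
    ⟨aestronglyMeasurable_id, hmom.lt_top⟩
  have hmom' : Integrable (fun x : EuclideanSpace ℝ (Fin d) => ‖x‖) Q := hid.norm
  set P := (volume : Measure (EuclideanSpace ℝ (Fin d))).withDensity fun x => EReal.exp (ψ x)
    with hP
  have hPac : P ≪ volume := withDensity_absolutelyContinuous _ _
  have hgrow : ∀ (f : EuclideanSpace ℝ (Fin d) →L[ℝ] ℝ) (c : ℝ),
      ∃ K : ℝ, 0 < K ∧ ∀ x, |f x + c| ≤ K * (1 + ‖x‖) := by
    intro f c
    refine ⟨‖f‖ + |c| + 1, by positivity, fun x => ?_⟩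
    have h1 := f.le_opNorm x
    have h2 := abs_add_le (f x) c
    rw [Real.norm_eq_abs] at h1
    have h3 : 0 ≤ |c| * ‖x‖ := by positivity
    nlinarith [norm_nonneg f, norm_nonneg x]
  have haff : ∀ (f : EuclideanSpace ℝ (Fin d) →L[ℝ] ℝ) (c : ℝ),
      ConvexOn ℝ univ fun x => f x + c := by
    intro f c
    exact (f.toLinearMap.convexOn convex_univ).add_const c
  constructor
  · intro h hb hc
    obtain ⟨f, c, hle, hsup⟩ := EConv.exists_seq volume hb (hc : EConv h)
    let F : ℕ → EuclideanSpace ℝ (Fin d) → ℝ := fun n x => f n x + c n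
    let G : ℕ → EuclideanSpace ℝ (Fin d) → ℝ := fun n => partialSups F n
    have hG : ∀ n, Continuous (G n) ∧ ConvexOn ℝ univ (G n) ∧
        (∃ K : ℝ, 0 < K ∧ ∀ x, |G n x| ≤ K * (1 + ‖x‖)) ∧ ∀ x, ((G n x : ℝ) : EReal) ≤ h x := by
      intro n
      induction n with
      | zero =>
        have : G 0 = F 0 := partialSups_zero F
        rw [this]
        exact ⟨by fun_prop, haff _ _, hgrow _ _, hle 0⟩
      | succ n ih =>
        obtain ⟨i1, i2, ⟨K, hK, i3⟩, i4⟩ := ih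
        obtain ⟨K', hK', j3⟩ := hgrow (f (n + 1)) (c (n + 1))
        have e : G (n + 1) = G n ⊔ F (n + 1) := partialSups_add_one F n
        rw [e]
        have hF : Continuous (F (n + 1)) := by fun_prop
        refine ⟨i1.sup hF, i2.sup (haff _ _), ⟨K + K', by positivity, fun x => ?_⟩, fun x => ?_⟩
        · have h1 : |(G n ⊔ F (n + 1)) x| ≤ max |G n x| |F (n + 1) x| :=
            abs_max_le_max_abs_abs
          refine h1.trans (max_le ((i3 x).trans ?_) ((j3 x).trans ?_))
          · gcongr; linarith
          · gcongr; linarith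
        · rcases le_total (G n x) (F (n + 1) x) with h1 | h1
          · rw [Pi.sup_apply, sup_eq_right.2 h1]; exact hle (n + 1) x
          · rw [Pi.sup_apply, sup_eq_left.2 h1]; exact i4 x
    have hmono : ∀ x, Monotone fun n => ((G n x : ℝ) : EReal) := by
      intro x m n hmn
      exact EReal.coe_le_coe_iff.2 ((partialSups F).monotone hmn x)
    have hlim : ∀ᵐ x ∂P, Tendsto (fun n => ((G n x : ℝ) : EReal)) atTop (𝓝 (h x)) := by
      refine hPac.ae_le ?_
      filter_upwards [hsup] with x hx
      have h1 := tendsto_atTop_iSup (hmono x)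
      have h2 : (⨆ n, ((G n x : ℝ) : EReal)) = h x := by
        apply le_antisymm (iSup_le fun n => (hG n).2.2.2 x)
        rw [← hx]
        exact iSup_mono fun n => EReal.coe_le_coe_iff.2 (le_partialSups F n x)
      rwa [h2] at h1
    have hkey : ∀ n, Integrable (G n) P ∧ Integrable (G n) Q ∧
        ∫ x, G n x ∂P ≤ ∫ x, G n x ∂Q := by
      intro n
      obtain ⟨i1, i2, ⟨K, hK, i3⟩, -⟩ := hG n
      exact hψ.key' hmom' i1 i2 hK i3
    have hmeas : ∀ n, Measurable fun x => ((G n x : ℝ) : EReal) := fun n =>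
      (hG n).1.measurable.coe_real_ereal
    have hpos : Tendsto (fun n => ∫⁻ x, ((G n x : ℝ) : EReal).toENNReal ∂P) atTop
        (𝓝 (∫⁻ x, (h x).toENNReal ∂P)) := by
      refine lintegral_tendsto_of_tendsto_of_monotone
        (fun n => (hmeas n).ereal_toENNReal.aemeasurable)
        (ae_of_all _ fun x m n hmn => EReal.toENNReal_le_toENNReal (hmono x hmn)) ?_
      filter_upwards [hlim] with x hx
      exact (EReal.continuous_toENNReal.tendsto _).comp hx
    have hneg0 : ∫⁻ x, (-((G 0 x : ℝ) : EReal)).toENNReal ∂P ≠ ⊤ :=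
      (hkey 0).1.neg.lintegral_lt_top.ne
    have hneg : Tendsto (fun n => ∫⁻ x, (-((G n x : ℝ) : EReal)).toENNReal ∂P) atTop
        (𝓝 (∫⁻ x, (-(h x)).toENNReal ∂P)) := by
      refine lintegral_tendsto_of_tendsto_of_antitone
        (fun n => (hmeas n).neg.ereal_toENNReal.aemeasurable)
        (ae_of_all _ fun x m n hmn => EReal.toENNReal_le_toENNReal
          (EReal.neg_le_neg_iff.2 (hmono x hmn))) hneg0 ?_
      filter_upwards [hlim] with x hx
      exact (EReal.continuous_toENNReal.tendsto _).comp ((continuous_neg.tendsto _).comp hx)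
    have hnegfin : ∫⁻ x, (-(h x)).toENNReal ∂P ≠ ⊤ := by
      refine ne_top_of_le_ne_top hneg0 (lintegral_mono fun x => ?_)
      exact EReal.toENNReal_le_toENNReal (EReal.neg_le_neg_iff.2 ((hG 0).2.2.2 x))
    have hE : Tendsto (fun n => eint P fun x => ((G n x : ℝ) : EReal)) atTop (𝓝 (eint P h)) := by
      have c1 := (EReal.tendsto_coe_ennreal.2 hpos)
      have c2 := (continuous_neg.tendsto _).comp (EReal.tendsto_coe_ennreal.2 hneg)
      have c3 := (EReal.continuousAt_add (p := (((∫⁻ x, (h x).toENNReal ∂P : ℝ≥0∞) : EReal),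
        -((∫⁻ x, (-(h x)).toENNReal ∂P : ℝ≥0∞) : EReal))) (Or.inr (by simpa using hnegfin))
        (Or.inl (EReal.coe_ennreal_ne_bot _))).tendsto.comp (c1.prodMk_nhds c2)
      exact c3
    refine le_of_tendsto hE (Eventually.of_forall fun n => ?_)
    obtain ⟨k1, k2, k3⟩ := hkey n
    refine le_trans ?_ (eint_mono Q (hG n).2.2.2)
    rw [eint_coe k1, eint_coe k2, EReal.coe_le_coe_iff]
    exact k3
  · have hlin : ∀ f : EuclideanSpace ℝ (Fin d) →L[ℝ] ℝ,
        Integrable (fun x => f x) P ∧ ∫ x, f x ∂P = ∫ x, f x ∂Q := by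
      have hh : ∀ f : EuclideanSpace ℝ (Fin d) →L[ℝ] ℝ, Integrable (fun x => f x) P ∧
          ∫ x, f x ∂P ≤ ∫ x, f x ∂Q := by
        intro f
        obtain ⟨K, hK, hf⟩ := hgrow f 0
        have h1 := haff f 0
        simp only [add_zero] at hf h1
        have := hψ.key' hmom' f.continuous h1 hK hf
        exact ⟨this.1, this.2.2⟩
      intro f
      refine ⟨(hh f).1, le_antisymm (hh f).2 ?_⟩
      have := (hh (-f)).2
      simp only [neg_apply, integral_neg] at this
      linarith
    have hidP : Integrable (fun x : EuclideanSpace ℝ (Fin d) => x) P := by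
      have hn := (hψ.key' hmom' continuous_norm convexOn_univ_norm one_pos
        (fun x => by rw [abs_norm]; linarith)).1
      exact (integrable_norm_iff aestronglyMeasurable_id).1 hn
    ext i
    have e1 := (EuclideanSpace.proj (𝕜 := ℝ) i).integral_comp_comm hidP
    have e2 := (EuclideanSpace.proj (𝕜 := ℝ) i).integral_comp_comm hid
    have e3 := (hlin (EuclideanSpace.proj (𝕜 := ℝ) i)).2
    rw [e1, e2] at e3
    exact e3
end
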